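/- arXiv:1903.11569 — 4 statements merged into one kernel-verified Lean document; each statement's English description precedes it below -/
import Mathlib

section
/- Let ω = e^{2πi/3}. Let f_1, f_2, f_3, f_4 be nonzero pairwise non-proportional binary quadratic forms over ℂ and λ_1, …, λ_4 nonzero complex scalars with λ_1 f_1^4 + λ_2 f_2^4 + λ_3 f_3^4 + λ_4 f_4^4 = 0. Define the quadratics A_1 = x²+y², A_2 = ωx²+ω²y², A_3 = ω²x²+ωy², A_4 = xy, and g_1 = x²+√3 xy−y², g_2 = x²−√3 xy−y², g_3(x,y) = g_1(ω²x, ωy), g_4(x,y) = g_2(ω²x, ωy), g_5(x,y) = g_1(ωx, ω²y), g_6(x,y) = g_2(ωx, ω²y). Then either {f_1,…,f_4} is a cousin of {A_1, A_2, A_3, A_4}, or {f_1,…,f_4} is a cousin of some 4-element subset of {g_1,…,g_6} whose fourth powers are linearly dependent over ℂ. -/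
open MvPolynomial Finset

/-- The variable `x` in `ℂ[x,y]`. -/
noncomputable def Px : MvPolynomial (Fin 2) ℂ := MvPolynomial.X 0

/-- The variable `y` in `ℂ[x,y]`. -/
noncomputable def Py : MvPolynomial (Fin 2) ℂ := MvPolynomial.X 1

/-- The substitution `(x,y) ↦ (αx + βy, γx + δy)` applied to a binary form. -/
noncomputable def linChange (a b c d : ℂ) (g : MvPolynomial (Fin 2) ℂ) :
    MvPolynomial (Fin 2) ℂ :=
  MvPolynomial.aeval ![C a * Px + C b * Py, C c * Px + C d * Py] g

/-- Two families of binary forms are cousins: one is obtained from the other by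
an invertible linear change of variables, a permutation, and nonzero scalings. -/
def Cousin {r : ℕ} (f g : Fin r → MvPolynomial (Fin 2) ℂ) : Prop :=
  ∃ (a b c d : ℂ) (π : Equiv.Perm (Fin r)) (cs : Fin r → ℂ),
    a * d - b * c ≠ 0 ∧ (∀ j, cs j ≠ 0) ∧
    ∀ j, f j = C (cs j) * linChange a b c d (g (π j))

/-- The primitive cube root of unity `ω = e^{2πi/3}`. -/
noncomputable def omega : ℂ := Complex.exp (2 * (Real.pi : ℂ) * Complex.I / 3)

/-- The quadratics `A_1 = x²+y²`, `A_2 = ωx²+ω²y²`, `A_3 = ω²x²+ωy²`, `A_4 = xy`. -/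
noncomputable def quartForm : Fin 4 → MvPolynomial (Fin 2) ℂ :=
  ![Px ^ 2 + Py ^ 2,
    C omega * Px ^ 2 + C (omega ^ 2) * Py ^ 2,
    C (omega ^ 2) * Px ^ 2 + C omega * Py ^ 2,
    Px * Py]

/-- The quadratics `g_1 = x²+√3 xy−y²`, `g_2 = x²−√3 xy−y²`,
`g_3(x,y) = g_1(ω²x, ωy)`, `g_4(x,y) = g_2(ω²x, ωy)`, `g_5(x,y) = g_1(ωx, ω²y)`,
`g_6(x,y) = g_2(ωx, ω²y)`. -/
noncomputable def quartForm' : Fin 6 → MvPolynomial (Fin 2) ℂ :=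
  ![Px ^ 2 + C ((Real.sqrt 3 : ℂ)) * Px * Py - Py ^ 2,
    Px ^ 2 - C ((Real.sqrt 3 : ℂ)) * Px * Py - Py ^ 2,
    linChange (omega ^ 2) 0 0 omega
      (Px ^ 2 + C ((Real.sqrt 3 : ℂ)) * Px * Py - Py ^ 2),
    linChange (omega ^ 2) 0 0 omega
      (Px ^ 2 - C ((Real.sqrt 3 : ℂ)) * Px * Py - Py ^ 2),
    linChange omega 0 0 (omega ^ 2)
      (Px ^ 2 + C ((Real.sqrt 3 : ℂ)) * Px * Py - Py ^ 2),
    linChange omega 0 0 (omega ^ 2)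
      (Px ^ 2 - C ((Real.sqrt 3 : ℂ)) * Px * Py - Py ^ 2)]

namespace Polynomial

/-- For three independent quadratics and a fourth, the differences of cubes share a quartic
factor. -/
lemma exists_common_quartic (s a b c : Fin 4 → ℂ)
    (ha : ∑ i, s i * a i = 0) (hb : ∑ i, s i * b i = 0) (hc : ∑ i, s i * c i = 0)
    (h4 : ∀ x, ∑ i, s i * (a i * x ^ 2 + b i * x + c i) ^ 4 = 0) :
    ∃ (α : ℂ[X]) (N : Fin 4 → ℂ[X]), α.natDegree ≤ 4 ∧
      (∀ i, (N i).natDegree ≤ 2) ∧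
      ∀ i, i ≠ 3 → C (a 0 * (b 1 * c 2 - b 2 * c 1) - b 0 * (a 1 * c 2 - a 2 * c 1)
          + c 0 * (a 1 * b 2 - a 2 * b 1)) * (C (s i) *
        ((C (a i) * X ^ 2 + C (b i) * X
            + C (c i)) ^ 3 -
          (C (a 3) * X ^ 2 + C (b 3) * X
            + C (c 3)) ^ 3)) = α * N i := by
  obtain ⟨q, hq⟩ : ∃ q : Fin 4 → ℂ[X], ∀ i, q i = C (a i) * X ^ 2 + C (b i) * X + C (c i) :=
    ⟨_, fun _ => rfl⟩
  have hP : ∑ i, C (s i) * q i ^ 4 = 0 := by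
    apply Polynomial.funext
    intro x
    simpa [hq, eval_finsetSum] using h4 x
  have hL : ∑ i, C (s i) * q i = 0 := by
    have h1 := congrArg (C (R := ℂ)) ha
    have h2 := congrArg (C (R := ℂ)) hb
    have h3 := congrArg (C (R := ℂ)) hc
    simp only [Fin.sum_univ_four, map_add, map_mul, map_zero, hq] at h1 h2 h3 ⊢
    linear_combination X ^ 2 * h1 + X * h2 + h3
  have hD : ∑ i, C (s i) * q i ^ 3 * (2 * C (a i) * X + C (b i)) = 0 := by
    have h := congrArg derivative hP
    have hd : ∀ i, derivative (q i) = 2 * C (a i) * X + C (b i) := by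
      intro i
      simp [hq]
      ring
    simp only [Fin.sum_univ_four, derivative_add, derivative_mul, derivative_pow,
      hd, derivative_zero] at h ⊢
    have e4 : (C ((4 : ℕ) : ℂ) : ℂ[X]) = 4 := by exact_mod_cast map_natCast C 4
    have e0 : ∀ i, derivative (C (s i)) = 0 := fun i => derivative_C
    simp only [e0, e4] at h
    refine (mul_eq_zero.mp ?_).resolve_left (show (4 : ℂ[X]) ≠ 0 by rw [← e4]; simp)
    linear_combination h
  have hE : ∑ i, C (s i) * (2 * C (a i) * X + C (b i)) = 0 := by
    have h1 := congrArg (C (R := ℂ)) ha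
    have h2 := congrArg (C (R := ℂ)) hb
    simp only [Fin.sum_univ_four, map_add, map_mul, map_zero] at h1 h2 ⊢
    linear_combination 2 * X * h1 + h2
  obtain ⟨G, hG⟩ : ∃ G : Fin 4 → ℂ[X], ∀ i, G i = C (s i) * (q i ^ 3 - q 3 ^ 3) :=
    ⟨_, fun _ => rfl⟩
  obtain ⟨α, hα⟩ : ∃ α : ℂ[X], α = G 0 * C (a 0) + G 1 * C (a 1) + G 2 * C (a 2) := ⟨_, rfl⟩
  have hβ : G 0 * C (b 0) + G 1 * C (b 1) + G 2 * C (b 2) = -2 * X * α := by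
    simp only [Fin.sum_univ_four] at hD hE
    simp only [hα, hG]
    linear_combination hD - q 3 ^ 3 * hE
  have hγ : G 0 * C (c 0) + G 1 * C (c 1) + G 2 * C (c 2) = X ^ 2 * α := by
    have h : G 0 * q 0 + G 1 * q 1 + G 2 * q 2 = 0 := by
      simp only [Fin.sum_univ_four] at hP hL
      simp only [hG]
      linear_combination hP - q 3 ^ 3 * hL
    simp only [hq] at h
    rw [hα] at hβ ⊢
    linear_combination h - X * hβ
  have hqd : ∀ i, (q i).natDegree ≤ 2 := fun i => by
    simp only [hq]; compute_degree
  have hGd : ∀ i, (G i).natDegree ≤ 6 := fun i => by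
    have h1 : (q i ^ 3).natDegree ≤ 6 := natDegree_pow_le_of_le 3 (hqd i)
    have h2 : (q 3 ^ 3).natDegree ≤ 6 := natDegree_pow_le_of_le 3 (hqd 3)
    exact (hG i) ▸ (natDegree_C_mul_le _ _).trans ((natDegree_sub_le _ _).trans (max_le h1 h2))
  have hαd : α.natDegree ≤ 4 := by
    by_cases h0 : α = 0
    · simp [h0]
    have h1 : (X ^ 2 * α).natDegree ≤ 6 := by
      rw [← hγ]
      refine natDegree_add_le_of_degree_le (natDegree_add_le_of_degree_le ?_ ?_) ?_ <;>
        exact (natDegree_mul_C_le _ _).trans (hGd _)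
    rw [natDegree_mul (pow_ne_zero 2 X_ne_zero) h0, natDegree_X_pow] at h1
    omega
  refine ⟨α, ![C (b 1 * c 2 - b 2 * c 1) + C (2 * (a 1 * c 2 - a 2 * c 1)) * X
      + C (a 1 * b 2 - a 2 * b 1) * X ^ 2,
    C (b 2 * c 0 - b 0 * c 2) + C (2 * (a 2 * c 0 - a 0 * c 2)) * X
      + C (a 2 * b 0 - a 0 * b 2) * X ^ 2,
    C (b 0 * c 1 - b 1 * c 0) + C (2 * (a 0 * c 1 - a 1 * c 0)) * X
      + C (a 0 * b 1 - a 1 * b 0) * X ^ 2, 0], hαd, ?_, ?_⟩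
  · intro i
    fin_cases i <;> dsimp <;> try compute_degree
    simp
  · intro i hi
    have e2 : (C (2 : ℂ) : ℂ[X]) = 2 := map_ofNat C 2
    rw [← hq, ← hq, ← hG]
    fin_cases i
    · simp only [map_add, map_sub, map_mul, e2]
      dsimp
      linear_combination (C (b 1) * C (c 2) - C (b 2) * C (c 1)) * (hα.symm) +
        (C (a 2) * C (c 1) - C (a 1) * C (c 2)) * hβ +
        (C (a 1) * C (b 2) - C (a 2) * C (b 1)) * hγ
    · simp only [map_add, map_sub, map_mul, e2]
      dsimp
      linear_combination (C (b 2) * C (c 0) - C (b 0) * C (c 2)) * (hα.symm) +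
        (C (a 0) * C (c 2) - C (a 2) * C (c 0)) * hβ +
        (C (a 2) * C (b 0) - C (a 0) * C (b 2)) * hγ
    · simp only [map_add, map_sub, map_mul, e2]
      dsimp
      linear_combination (C (b 0) * C (c 1) - C (b 1) * C (c 0)) * (hα.symm) +
        (C (a 1) * C (c 0) - C (a 0) * C (c 1)) * hβ +
        (C (a 0) * C (b 1) - C (a 1) * C (b 0)) * hγ
    · exact absurd rfl hi

/-- Normalised forms satisfying `∑ s F = 0` and `∑ s F ^ 4 = 0`: four distinct points at which
all cubes agree. -/
lemma exists_four_equal_cubes (s a b c : Fin 4 → ℂ) (hs : ∀ i, s i ≠ 0)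
    (ha : ∑ i, s i * a i = 0) (hb : ∑ i, s i * b i = 0) (hc : ∑ i, s i * c i = 0)
    (h4 : ∀ x, ∑ i, s i * (a i * x ^ 2 + b i * x + c i) ^ 4 = 0)
    (hdet : a 0 * (b 1 * c 2 - b 2 * c 1) - b 0 * (a 1 * c 2 - a 2 * c 1)
          + c 0 * (a 1 * b 2 - a 2 * b 1) ≠ 0)
    (hinf : ∃ i, a i ^ 3 ≠ a 3 ^ 3) :
    ∃ R : Finset ℂ, R.card = 4 ∧
      (∀ p ∈ R, a 3 * p ^ 2 + b 3 * p + c 3 ≠ 0 ∧ ∀ i, (a i * p ^ 2 + b i * p + c i) ^ 3 =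
        (a 3 * p ^ 2 + b 3 * p + c 3) ^ 3) ∧
      ∀ p ∈ R, ∀ q ∈ R, ∀ r, (∀ i, a i * p ^ 2 + b i * p + c i =
        r * (a i * q ^ 2 + b i * q + c i)) → p = q := by
  obtain ⟨α, N, hα, hN, h⟩ := exists_common_quartic s a b c ha hb hc h4
  obtain ⟨Δ, hΔ⟩ : ∃ Δ, Δ = a 0 * (b 1 * c 2 - b 2 * c 1) - b 0 * (a 1 * c 2 - a 2 * c 1)
          + c 0 * (a 1 * b 2 - a 2 * b 1) := ⟨_, rfl⟩
  rw [← hΔ] at h hdet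
  have hsol : ∀ u v w : ℂ, (∀ i, i ≠ 3 → u * a i + v * b i + w * c i = 0) →
      u = 0 ∧ v = 0 ∧ w = 0 := by
    intro u v w huvw
    have h0 := huvw 0 (by decide)
    have h1 := huvw 1 (by decide)
    have h2 := huvw 2 (by decide)
    refine ⟨?_, ?_, ?_⟩ <;> refine (mul_eq_zero.mp ?_).resolve_right hdet <;> rw [hΔ]
    · linear_combination (b 1 * c 2 - b 2 * c 1) * h0 + (b 2 * c 0 - b 0 * c 2) * h1
        + (b 0 * c 1 - b 1 * c 0) * h2
    · linear_combination (a 2 * c 1 - a 1 * c 2) * h0 + (a 0 * c 2 - a 2 * c 0) * h1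
        + (a 1 * c 0 - a 0 * c 1) * h2
    · linear_combination (a 1 * b 2 - a 2 * b 1) * h0 + (a 2 * b 0 - a 0 * b 2) * h1
        + (a 0 * b 1 - a 1 * b 0) * h2
  have hdeg : α.natDegree = 4 := by
    refine le_antisymm hα (not_lt.mp fun hlt => ?_)
    obtain ⟨i, hi⟩ := hinf
    have hi3 : i ≠ 3 := by rintro rfl; exact hi rfl
    have h6 := congrArg (fun P => P.coeff 6) (h i hi3)
    have hz : (α * N i).coeff 6 = 0 := by
      apply coeff_eq_zero_of_natDegree_lt
      have := natDegree_mul_le (p := α) (q := N i)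
      have := hN i
      omega
    have hcoef : ∀ i, ((C (a i) * X ^ 2 + C (b i) * X + C (c i)) ^ 3).coeff 6 = a i ^ 3 := by
      intro i
      exact coeff_pow_of_natDegree_le (n := 2) (m := 3) (by compute_degree) |>.trans (by simp)
    simp only [coeff_C_mul, coeff_sub, hcoef, hz] at h6
    have := (mul_eq_zero.mp ((mul_eq_zero.mp h6).resolve_left hdet)).resolve_left (hs i)
    exact hi (sub_eq_zero.mp this)
  have hα0 : α ≠ 0 := by rintro rfl; simp at hdeg
  have hcube : ∀ p, α.IsRoot p → ∀ i, (a i * p ^ 2 + b i * p + c i) ^ 3 =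
        (a 3 * p ^ 2 + b 3 * p + c 3) ^ 3 := by
    intro p hp i
    by_cases hi3 : i = 3
    · rw [hi3]
    have he := congrArg (eval p) (h i hi3)
    simp only [eval_mul, hp.eq_zero, eval_sub, eval_pow, eval_add, eval_C, eval_X, zero_mul] at he
    have := (mul_eq_zero.mp ((mul_eq_zero.mp he).resolve_left hdet)).resolve_left (hs i)
    exact sub_eq_zero.mp this
  have hval : ∀ p, α.IsRoot p → a 3 * p ^ 2 + b 3 * p + c 3 ≠ 0 := by
    intro p hp h0
    have h1 := (hsol (p ^ 2) p 1 fun i _ => by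
      have := hcube p hp i
      rw [h0] at this
      have := pow_eq_zero_iff (n := 3) (by norm_num) |>.mp (this.trans (by norm_num))
      linear_combination this).2.2
    exact one_ne_zero h1
  have hsimple : ∀ p, ¬ 1 < α.rootMultiplicity p := by
    intro p hp
    obtain ⟨hr, hr'⟩ := (one_lt_rootMultiplicity_iff_isRoot hα0).mp hp
    have hv := hval p hr
    obtain ⟨V, hV⟩ : ∃ V, V = a 3 * p ^ 2 + b 3 * p + c 3 := ⟨_, rfl⟩
    obtain ⟨V', hV'⟩ : ∃ V, V = 2 * a 3 * p + b 3 := ⟨_, rfl⟩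
    rw [← hV] at hv
    have h1 := (hsol (V' * p ^ 2 - 2 * V * p) (V' * p - V) V' fun i hi => by
      have he := congrArg (fun P => eval p (derivative P)) (h i hi)
      simp only [derivative_mul, derivative_C, derivative_sub, derivative_pow, derivative_add,
        derivative_X, eval_mul, hr.eq_zero, hr'.eq_zero, eval_sub, eval_pow, eval_add, eval_C,
        eval_X, zero_mul, zero_add, add_zero] at he
      have he := (mul_eq_zero.mp ((mul_eq_zero.mp he).resolve_left hdet)).resolve_left (hs i)
      simp at he
      have hcb := hcube p hr i
      rw [← hV] at hcb
      obtain ⟨W, hW⟩ : ∃ W, W = a i * p ^ 2 + b i * p + c i := ⟨_, rfl⟩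
      rw [← hW, ← hV] at he
      rw [← hW] at hcb
      have hW0 : W ≠ 0 := by
        rintro rfl
        exact hv (by simpa using hcb.symm)
      refine (mul_eq_zero.mp ?_).resolve_left (pow_ne_zero 2 hv)
      have e1 : W ^ 2 * (2 * a i * p + b i) = V ^ 2 * V' := by
        rw [hV']; linear_combination he / 3
      have e2 : W ^ 2 * (V' * W - V * (2 * a i * p + b i)) = 0 := by
        linear_combination V' * hcb - V * e1
      have e3 := (mul_eq_zero.mp e2).resolve_left (pow_ne_zero 2 hW0)
      rw [hW] at e3
      linear_combination V ^ 2 * e3)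
    have h2 : V = 0 := by linear_combination p * h1.2.2 - h1.2.1
    exact hv h2
  have hnodup : α.roots.Nodup := by
    rw [Multiset.nodup_iff_count_le_one]
    intro p
    rw [count_roots]
    exact not_lt.mp (hsimple p)
  have hmem : ∀ p ∈ α.roots.toFinset, α.IsRoot p := fun p hp =>
    isRoot_of_mem_roots (Multiset.mem_toFinset.mp hp)
  refine ⟨α.roots.toFinset, ?_, fun p hp => ⟨hval p (hmem p hp), hcube p (hmem p hp)⟩, ?_⟩
  · rw [Multiset.toFinset_card_of_nodup hnodup, IsAlgClosed.card_roots_eq_natDegree, hdeg]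
  · intro p _ q _ r hpq
    have h1 := hsol (p ^ 2 - r * q ^ 2) (p - r * q) (1 - r) fun i _ => by
      linear_combination hpq i
    linear_combination h1.2.1 - q * h1.2.2

end Polynomial

lemma sum_dichotomy {s₁ s₂ s₃ s₄ p₁ p₂ p₃ p₄ q₁ q₂ q₃ q₄ : ℂ}
    (h₃ : s₃ ≠ 0) (h₄ : s₄ ≠ 0) (hp : p₁ ≠ 0) (hq : q₁ ≠ 0)
    (hp₂ : p₂ ^ 3 = p₁ ^ 3) (hp₃ : p₃ ^ 3 = p₁ ^ 3) (hp₄ : p₄ ^ 3 = p₁ ^ 3)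
    (hq₃ : q₃ ^ 3 = q₁ ^ 3) (hq₄ : q₄ ^ 3 = q₁ ^ 3)
    (hr : p₂ * q₁ = q₂ * p₁)
    (hsp : s₁ * p₁ + s₂ * p₂ + s₃ * p₃ + s₄ * p₄ = 0)
    (hsq : s₁ * q₁ + s₂ * q₂ + s₃ * q₃ + s₄ * q₄ = 0)
    (hne : ¬ (p₃ * q₁ = q₃ * p₁ ∧ p₄ * q₁ = q₄ * p₁)) :
    (s₁ ^ 3 + s₂ ^ 3 = 0 ∧ s₃ ^ 3 + s₄ ^ 3 = 0) ∨
    (s₃ ^ 3 = s₄ ^ 3 ∧ ∃ ζ ζ' : ℂ, ζ ^ 3 = 1 ∧ ζ' ^ 3 = 1 ∧ s₁ + ζ * s₂ = ζ' * s₃) := by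
  have hp₃0 : p₃ ≠ 0 := by rintro rfl; exact hp (by simpa using hp₃.symm)
  have hp₄0 : p₄ ≠ 0 := by rintro rfl; exact hp (by simpa using hp₄.symm)
  obtain ⟨z, hz⟩ : ∃ z, z = p₂ / p₁ := ⟨_, rfl⟩
  obtain ⟨u, hu⟩ : ∃ z, z = p₃ / p₁ := ⟨_, rfl⟩
  obtain ⟨v, hv⟩ : ∃ z, z = p₄ / p₁ := ⟨_, rfl⟩
  obtain ⟨r, hrr⟩ : ∃ r, r = (q₃ * p₁) / (q₁ * p₃) := ⟨_, rfl⟩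
  obtain ⟨t, ht⟩ : ∃ t, t = (q₄ * p₁) / (q₁ * p₄) := ⟨_, rfl⟩
  have hz3 : z ^ 3 = 1 := by rw [hz, div_pow, hp₂, div_self (pow_ne_zero _ hp)]
  have hu3 : u ^ 3 = 1 := by rw [hu, div_pow, hp₃, div_self (pow_ne_zero _ hp)]
  have hv3 : v ^ 3 = 1 := by rw [hv, div_pow, hp₄, div_self (pow_ne_zero _ hp)]
  have hr3 : r ^ 3 = 1 := by
    rw [hrr, div_pow, mul_pow, mul_pow, hq₃, hp₃, div_self (by positivity)]
  have ht3 : t ^ 3 = 1 := by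
    rw [ht, div_pow, mul_pow, mul_pow, hq₄, hp₄, div_self (by positivity)]
  have hu0 : u ≠ 0 := by rintro rfl; norm_num at hu3
  have hv0 : v ≠ 0 := by rintro rfl; norm_num at hv3
  have e1 : s₁ + s₂ * z + s₃ * u + s₄ * v = 0 := by
    rw [hz, hu, hv]; field_simp; linear_combination hsp
  have e2 : s₁ + s₂ * z + s₃ * u * r + s₄ * v * t = 0 := by
    rw [hz, hu, hv, hrr, ht]; field_simp
    linear_combination p₁ * hsq + s₂ * hr
  have hnr : ¬ (r = 1 ∧ t = 1) := by
    rintro ⟨h, h'⟩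
    apply hne
    rw [hrr, div_eq_one_iff_eq (by positivity)] at h
    rw [ht, div_eq_one_iff_eq (by positivity)] at h'
    constructor
    · linear_combination -h
    · linear_combination -h'
  have e3 : s₃ * u * (1 - r) + s₄ * v * (1 - t) = 0 := by linear_combination e1 - e2
  have hr1 : r ≠ 1 := by
    intro h
    apply hnr ⟨h, _⟩
    have : s₄ * v * (1 - t) = 0 := by rw [h] at e3; linear_combination e3
    have := (mul_eq_zero.mp this).resolve_left (mul_ne_zero h₄ hv0)
    linear_combination -this
  have ht1 : t ≠ 1 := by
    intro h
    apply hnr ⟨_, h⟩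
    have : s₃ * u * (1 - r) = 0 := by rw [h] at e3; linear_combination e3
    have := (mul_eq_zero.mp this).resolve_left (mul_ne_zero h₃ hu0)
    linear_combination -this
  have hr2 : r ^ 2 + r + 1 = 0 := by
    refine (mul_eq_zero.mp ?_).resolve_left (sub_ne_zero.mpr hr1)
    linear_combination hr3
  have ht2 : t ^ 2 + t + 1 = 0 := by
    refine (mul_eq_zero.mp ?_).resolve_left (sub_ne_zero.mpr ht1)
    linear_combination ht3
  have h1r : 1 - r ≠ 0 := sub_ne_zero.mpr (Ne.symm hr1)
  have hrt : (t - r) * (t + 1 + r) = 0 := by linear_combination ht2 - hr2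
  rcases mul_eq_zero.mp hrt with h | h
  · left
    have htr : t = r := by linear_combination h
    have e4 : s₃ * u + s₄ * v = 0 := by
      refine (mul_eq_zero.mp ?_).resolve_left h1r
      rw [htr] at e3; linear_combination e3
    constructor
    · have e5 : s₁ = - (s₂ * z) := by linear_combination e1 - e4
      rw [e5]; linear_combination -s₂ ^ 3 * hz3
    · have e5 : s₃ * u = - (s₄ * v) := by linear_combination e4
      have e6 : (s₃ * u) ^ 3 = (- (s₄ * v)) ^ 3 := by rw [e5]
      linear_combination e6 - s₃ ^ 3 * hu3 - s₄ ^ 3 * hv3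
  · right
    have htr : t = -1 - r := by linear_combination h
    have e4 : s₃ * u + s₄ * v * (1 + r) = 0 := by
      refine (mul_eq_zero.mp ?_).resolve_left h1r
      rw [htr] at e3; linear_combination e3 - s₄ * v * hr2
    have e5 : s₄ * v = r * (s₃ * u) := by
      linear_combination (s₄ * v) * hr2 - r * e4
    refine ⟨?_, z, r ^ 2 * u, hz3, ?_, ?_⟩
    · have e6 : (s₄ * v) ^ 3 = (r * (s₃ * u)) ^ 3 := by rw [e5]
      linear_combination -e6 - s₃ ^ 3 * hu3 * r ^ 3 + s₄ ^ 3 * hv3 - s₃ ^ 3 * hr3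
    · linear_combination (r ^ 3) ^ 2 * hu3 + (r ^ 3 + 1) * hr3
    · linear_combination e1 - e5 - s₃ * u * hr2

lemma sign_pattern {s : Fin 4 → ℂ} (hs : ∀ i, s i ≠ 0)
    (H : ∀ σ : Equiv.Perm (Fin 4),
      (s (σ 0) ^ 3 + s (σ 1) ^ 3 = 0 ∧ s (σ 2) ^ 3 + s (σ 3) ^ 3 = 0) ∨
      (s (σ 2) ^ 3 = s (σ 3) ^ 3 ∧
        ∃ ζ ζ' : ℂ, ζ ^ 3 = 1 ∧ ζ' ^ 3 = 1 ∧ s (σ 0) + ζ * s (σ 1) = ζ' * s (σ 2))) :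
    ∃ σ : Equiv.Perm (Fin 4), s (σ 1) ^ 3 = - s (σ 0) ^ 3 ∧ s (σ 2) ^ 3 = - s (σ 0) ^ 3 ∧
      s (σ 3) ^ 3 = s (σ 0) ^ 3 := by
  have h12 := H 1
  have h13 := H (Equiv.swap 1 2)
  have h23 := H (Equiv.swap 0 2)
  have e1 : (Equiv.swap 1 2 : Equiv.Perm (Fin 4)) 0 = 0 := by decide
  have e2 : (Equiv.swap 1 2 : Equiv.Perm (Fin 4)) 3 = 3 := by decide
  have e3 : (Equiv.swap 0 2 : Equiv.Perm (Fin 4)) 1 = 1 := by decide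
  have e4 : (Equiv.swap 0 2 : Equiv.Perm (Fin 4)) 3 = 3 := by decide
  simp only [Equiv.Perm.one_apply, Equiv.swap_apply_left, Equiv.swap_apply_right, e1, e2, e3, e4]
    at h12 h13 h23
  rcases h12 with ⟨h1, h2⟩ | ⟨h1, ζ, ζ', hζ, hζ', h2⟩
  · rcases h13 with ⟨h3, h4⟩ | ⟨h3, -⟩
    · refine ⟨1, ?_, ?_, ?_⟩ <;> simp only [Equiv.Perm.one_apply]
      · linear_combination h1
      · linear_combination h3
      · linear_combination h2 - h3
    · refine ⟨Equiv.swap 2 3, ?_, ?_, ?_⟩ <;>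
        simp only [Equiv.swap_apply_left, Equiv.swap_apply_right,
          show (Equiv.swap 2 3 : Equiv.Perm (Fin 4)) 0 = 0 by decide,
          show (Equiv.swap 2 3 : Equiv.Perm (Fin 4)) 1 = 1 by decide]
      · linear_combination h1
      · linear_combination h1 - h3
      · linear_combination h2 - h1 + h3
  · rcases h13 with ⟨h3, h4⟩ | ⟨h3, -⟩
    · refine ⟨Equiv.swap 1 3, ?_, ?_, ?_⟩ <;>
        simp only [Equiv.swap_apply_left, Equiv.swap_apply_right,
          show (Equiv.swap 1 3 : Equiv.Perm (Fin 4)) 0 = 0 by decide,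
          show (Equiv.swap 1 3 : Equiv.Perm (Fin 4)) 2 = 2 by decide]
      · linear_combination h3 - h1
      · linear_combination h3
      · linear_combination h4 - h3 + h1
    · exfalso
      rcases h23 with ⟨h5, -⟩ | ⟨h5, -⟩
      · have h6 : 2 * s 2 ^ 3 = 0 := by linear_combination h5 + h1 - h3
        exact hs 2 (by simpa using h6)
      · obtain ⟨η, hη⟩ : ∃ η, η = ζ * s 1 / s 0 := ⟨_, rfl⟩
        obtain ⟨θ, hθ⟩ : ∃ θ, θ = ζ' * s 2 / s 0 := ⟨_, rfl⟩
        have h0 := hs 0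
        have e1 : η ^ 3 = 1 := by
          rw [hη, div_pow, mul_pow, hζ, h3, ← h5, one_mul, div_self (pow_ne_zero _ h0)]
        have e2 : θ ^ 3 = 1 := by
          rw [hθ, div_pow, mul_pow, hζ', h1, ← h5, one_mul, div_self (pow_ne_zero _ h0)]
        have e3 : θ = 1 + η := by
          rw [hθ, hη]; field_simp; linear_combination -h2
        have e4 : 3 * η ^ 2 + 3 * η + 1 = 0 := by
          rw [e3] at e2; linear_combination e2 - e1
        have e5 : (14 : ℂ) = 0 := by
          linear_combination (2 + (η - 1) * (3 * η + 6)) * e4 - 3 * (3 * η + 6) * e1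
        norm_num at e5

lemma coeff_relations (l a b c : Fin 4 → ℂ)
    (h : ∀ x : ℂ, ∑ i, l i * (a i * x ^ 2 + b i * x + c i) ^ 4 = 0) :
    ∑ i, l i * c i ^ 4 = 0 ∧ ∑ i, l i * (c i ^ 3 * b i) = 0 ∧
    ∑ i, l i * (2 * (c i ^ 3 * a i) + 3 * (c i ^ 2 * b i ^ 2)) = 0 ∧
    ∑ i, l i * (3 * (c i ^ 2 * a i * b i) + c i * b i ^ 3) = 0 ∧
    ∑ i, l i * (6 * (c i ^ 2 * a i ^ 2) + 12 * (c i * b i ^ 2 * a i) + b i ^ 4) = 0 := by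
  obtain ⟨P, hP⟩ : ∃ P : Polynomial ℂ, P = ∑ i, Polynomial.C (l i) *
    (Polynomial.C (c i ^ 4) + Polynomial.C (4 * (c i ^ 3 * b i)) * Polynomial.X
      + Polynomial.C (2 * (2 * (c i ^ 3 * a i) + 3 * (c i ^ 2 * b i ^ 2))) * Polynomial.X ^ 2
      + Polynomial.C (4 * (3 * (c i ^ 2 * a i * b i) + c i * b i ^ 3)) * Polynomial.X ^ 3
      + Polynomial.C (6 * (c i ^ 2 * a i ^ 2) + 12 * (c i * b i ^ 2 * a i) + b i ^ 4)
        * Polynomial.X ^ 4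
      + Polynomial.C (4 * (3 * (a i ^ 2 * c i * b i) + a i * b i ^ 3)) * Polynomial.X ^ 5
      + Polynomial.C (2 * (2 * (a i ^ 3 * c i) + 3 * (a i ^ 2 * b i ^ 2))) * Polynomial.X ^ 6
      + Polynomial.C (4 * (a i ^ 3 * b i)) * Polynomial.X ^ 7
      + Polynomial.C (a i ^ 4) * Polynomial.X ^ 8) := ⟨_, rfl⟩
  have hP0 : P = 0 := by
    apply Polynomial.funext
    intro x
    have := h x
    simp only [Fin.sum_univ_four] at this
    simp only [hP, Fin.sum_univ_four, Polynomial.eval_add, Polynomial.eval_mul, Polynomial.eval_C,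
      Polynomial.eval_X, Polynomial.eval_pow, Polynomial.eval_zero]
    linear_combination this
  have hk : ∀ k, P.coeff k = 0 := by simp [hP0]
  rw [hP] at hk
  have h0 := hk 0
  have h1 := hk 1
  have h2 := hk 2
  have h3 := hk 3
  have h4 := hk 4
  simp only [Polynomial.coeff_C_mul, Polynomial.coeff_add, Polynomial.coeff_C,
    Polynomial.coeff_X, Polynomial.coeff_X_pow, Fin.sum_univ_four] at h0 h1 h2 h3 h4
  norm_num at h0 h1 h2 h3 h4
  simp only [Fin.sum_univ_four]
  refine ⟨?_, ?_, ?_, ?_, ?_⟩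
  · linear_combination h0
  · linear_combination h1 / 4
  · linear_combination h2 / 2
  · linear_combination h3 / 4
  · linear_combination h4

/-- Three pairwise independent vectors in the plane cannot satisfy the first three moment
relations of degree four. -/
lemma no_moment_relation {l₁ l₂ l₃ m₁ m₂ m₃ n₁ n₂ n₃ : ℂ} (h₁ : l₁ ≠ 0) (h₂ : l₂ ≠ 0)
    (h₁₂ : m₁ * n₂ - n₁ * m₂ ≠ 0) (h₁₃ : m₁ * n₃ - n₁ * m₃ ≠ 0) (h₂₃ : m₂ * n₃ - n₂ * m₃ ≠ 0)
    (e₀ : l₁ * m₁ ^ 4 + l₂ * m₂ ^ 4 + l₃ * m₃ ^ 4 = 0)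
    (e₁ : l₁ * (m₁ ^ 3 * n₁) + l₂ * (m₂ ^ 3 * n₂) + l₃ * (m₃ ^ 3 * n₃) = 0)
    (e₂ : l₁ * (m₁ ^ 2 * n₁ ^ 2) + l₂ * (m₂ ^ 2 * n₂ ^ 2) + l₃ * (m₃ ^ 2 * n₃ ^ 2) = 0) :
    False := by
  have k₁ : m₁ = 0 := by
    have : (l₁ * ((m₁ * n₂ - n₁ * m₂) * (m₁ * n₃ - n₁ * m₃))) * m₁ ^ 2 = 0 := by
      linear_combination n₂ * n₃ * e₀ - (n₂ * m₃ + n₃ * m₂) * e₁ + m₂ * m₃ * e₂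
    exact (pow_eq_zero_iff (two_ne_zero)).mp
      ((mul_eq_zero.mp this).resolve_left (mul_ne_zero h₁ (mul_ne_zero h₁₂ h₁₃)))
  have k₂ : m₂ = 0 := by
    have : (l₂ * ((m₁ * n₂ - n₁ * m₂) * (m₂ * n₃ - n₂ * m₃))) * m₂ ^ 2 = 0 := by
      linear_combination -n₁ * n₃ * e₀ + (n₁ * m₃ + n₃ * m₁) * e₁ - m₁ * m₃ * e₂
    exact (pow_eq_zero_iff (two_ne_zero)).mp
      ((mul_eq_zero.mp this).resolve_left (mul_ne_zero h₂ (mul_ne_zero h₁₂ h₂₃)))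
  exact h₁₂ (by rw [k₁, k₂]; ring)

/-- In a pencil of quadratics, vanishing of the extreme coefficients of a combination of three
fourth powers forces a repeated factor in the pencil. -/
lemma pencil_square {l₁ l₂ l₃ a₁ a₂ a₃ b₁ b₂ b₃ c₁ c₂ c₃ u v : ℂ} (h₁ : l₁ ≠ 0) (h₂ : l₂ ≠ 0)
    (hu : u ≠ 0) (hv : v ≠ 0)
    (ha : a₃ = u * a₁ + v * a₂) (hb : b₃ = u * b₁ + v * b₂) (hc : c₃ = u * c₁ + v * c₂)
    (e₀ : l₁ * c₁ ^ 4 + l₂ * c₂ ^ 4 + l₃ * c₃ ^ 4 = 0)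
    (e₁ : l₁ * (c₁ ^ 3 * b₁) + l₂ * (c₂ ^ 3 * b₂) + l₃ * (c₃ ^ 3 * b₃) = 0)
    (e₂ : l₁ * (2 * (c₁ ^ 3 * a₁) + 3 * (c₁ ^ 2 * b₁ ^ 2))
      + l₂ * (2 * (c₂ ^ 3 * a₂) + 3 * (c₂ ^ 2 * b₂ ^ 2))
      + l₃ * (2 * (c₃ ^ 3 * a₃) + 3 * (c₃ ^ 2 * b₃ ^ 2)) = 0) :
    c₁ * b₂ - b₁ * c₂ = 0 := by
  by_contra hd
  obtain ⟨s, hs⟩ : ∃ s, s = (a₁ * b₂ - b₁ * a₂) / (c₁ * b₂ - b₁ * c₂) := ⟨_, rfl⟩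
  obtain ⟨t, ht⟩ : ∃ t, t = (c₁ * a₂ - a₁ * c₂) / (c₁ * b₂ - b₁ * c₂) := ⟨_, rfl⟩
  have k₁ : a₁ = s * c₁ + t * b₁ := by
    rw [hs, ht, div_mul_eq_mul_div, div_mul_eq_mul_div, ← add_div, eq_div_iff hd]; ring
  have k₂ : a₂ = s * c₂ + t * b₂ := by
    rw [hs, ht, div_mul_eq_mul_div, div_mul_eq_mul_div, ← add_div, eq_div_iff hd]; ring
  have k₃ : a₃ = s * c₃ + t * b₃ := by rw [ha, hb, hc, k₁, k₂]; ring
  refine no_moment_relation h₁ h₂ hd ?_ ?_ e₀ e₁ ?_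
  · rw [hb, hc]
    have := mul_ne_zero hv hd
    contrapose! this
    linear_combination this
  · rw [hb, hc]
    have := mul_ne_zero hu hd
    contrapose! this
    linear_combination -this
  · rw [k₁, k₂, k₃] at e₂
    linear_combination e₂ / 3 - 2 * s / 3 * e₀ - 2 * t / 3 * e₁

/-- A pencil whose combination of three fourth powers is `x ^ 8` does not exist. -/
lemma pencil_not_eighth_power {l₁ l₂ l₃ a₁ a₂ a₃ b₁ b₂ b₃ c₁ c₂ c₃ u v : ℂ}
    (h₁ : l₁ ≠ 0) (h₂ : l₂ ≠ 0) (hu : u ≠ 0) (hv : v ≠ 0)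
    (ha : a₃ = u * a₁ + v * a₂) (hb : b₃ = u * b₁ + v * b₂) (hc : c₃ = u * c₁ + v * c₂)
    (hne : ¬ (a₁ * b₂ = b₁ * a₂ ∧ a₁ * c₂ = c₁ * a₂ ∧ b₁ * c₂ = c₁ * b₂))
    (e₀ : l₁ * c₁ ^ 4 + l₂ * c₂ ^ 4 + l₃ * c₃ ^ 4 = 0)
    (e₁ : l₁ * (c₁ ^ 3 * b₁) + l₂ * (c₂ ^ 3 * b₂) + l₃ * (c₃ ^ 3 * b₃) = 0)
    (e₂ : l₁ * (2 * (c₁ ^ 3 * a₁) + 3 * (c₁ ^ 2 * b₁ ^ 2))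
      + l₂ * (2 * (c₂ ^ 3 * a₂) + 3 * (c₂ ^ 2 * b₂ ^ 2))
      + l₃ * (2 * (c₃ ^ 3 * a₃) + 3 * (c₃ ^ 2 * b₃ ^ 2)) = 0)
    (e₄ : l₁ * (6 * (c₁ ^ 2 * a₁ ^ 2) + 12 * (c₁ * b₁ ^ 2 * a₁) + b₁ ^ 4)
      + l₂ * (6 * (c₂ ^ 2 * a₂ ^ 2) + 12 * (c₂ * b₂ ^ 2 * a₂) + b₂ ^ 4)
      + l₃ * (6 * (c₃ ^ 2 * a₃ ^ 2) + 12 * (c₃ * b₃ ^ 2 * a₃) + b₃ ^ 4) = 0)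
    (e₅ : l₁ * (3 * (a₁ ^ 2 * c₁ * b₁) + a₁ * b₁ ^ 3)
      + l₂ * (3 * (a₂ ^ 2 * c₂ * b₂) + a₂ * b₂ ^ 3)
      + l₃ * (3 * (a₃ ^ 2 * c₃ * b₃) + a₃ * b₃ ^ 3) = 0)
    (e₆ : l₁ * (2 * (a₁ ^ 3 * c₁) + 3 * (a₁ ^ 2 * b₁ ^ 2))
      + l₂ * (2 * (a₂ ^ 3 * c₂) + 3 * (a₂ ^ 2 * b₂ ^ 2))
      + l₃ * (2 * (a₃ ^ 3 * c₃) + 3 * (a₃ ^ 2 * b₃ ^ 2)) = 0) : False := by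
  have hd := pencil_square h₁ h₂ hu hv ha hb hc e₀ e₁ e₂
  by_cases hcz : c₁ = 0 ∧ c₂ = 0
  · obtain ⟨rfl, rfl⟩ := hcz
    obtain rfl : c₃ = 0 := by rw [hc]; ring
    have hd' : b₁ * a₂ - a₁ * b₂ ≠ 0 := by
      intro h
      exact hne ⟨by linear_combination -h, by ring, by ring⟩
    refine no_moment_relation (l₃ := l₃) h₁ h₂ hd' ?_ ?_ ?_ ?_ ?_ (m₃ := b₃) (n₃ := a₃)
    · rw [hb, ha]
      have := mul_ne_zero hv hd'
      contrapose! this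
      linear_combination this
    · rw [hb, ha]
      have := mul_ne_zero hu hd'
      contrapose! this
      linear_combination -this
    · linear_combination e₄
    · linear_combination e₅
    · linear_combination e₆ / 3
  · obtain ⟨k, hk₁, hk₂⟩ : ∃ k, b₁ = k * c₁ ∧ b₂ = k * c₂ := by
      by_cases hc1 : c₁ = 0
      · have hc2 : c₂ ≠ 0 := fun h => hcz ⟨hc1, h⟩
        refine ⟨b₂ / c₂, ?_, ?_⟩ <;> field_simp
        linear_combination -hd
      · refine ⟨b₁ / c₁, ?_, ?_⟩ <;> field_simp
        linear_combination hd
    have hk₃ : b₃ = k * c₃ := by rw [hb, hc, hk₁, hk₂]; ring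
    subst hk₁ hk₂ hk₃
    have hd' : c₁ * a₂ - a₁ * c₂ ≠ 0 := by
      intro h
      exact hne ⟨by linear_combination -k * h, by linear_combination -h, by ring⟩
    have f₁ : l₁ * (c₁ ^ 3 * a₁) + l₂ * (c₂ ^ 3 * a₂) + l₃ * (c₃ ^ 3 * a₃) = 0 := by
      linear_combination e₂ / 2 - 3 / 2 * k ^ 2 * e₀
    refine no_moment_relation (l₃ := l₃) h₁ h₂ hd' ?_ ?_ e₀ f₁ ?_
    · rw [hc, ha]
      have := mul_ne_zero hv hd'
      contrapose! this
      linear_combination this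
    · rw [hc, ha]
      have := mul_ne_zero hu hd'
      contrapose! this
      linear_combination -this
    · linear_combination e₄ / 6 - 2 * k ^ 2 * f₁ - k ^ 4 / 6 * e₀

/-- Three fourth powers of binary linear forms summing to a multiple of `U ^ 2 * V ^ 2`. -/
lemma three_fourth_powers {l₁ l₂ l₃ a₁ a₂ a₃ c₁ c₂ c₃ : ℂ}
    (h₁ : l₁ ≠ 0) (h₂ : l₂ ≠ 0)
    (h₁₂ : a₁ * c₂ - c₁ * a₂ ≠ 0) (h₁₃ : a₁ * c₃ - c₁ * a₃ ≠ 0) (h₂₃ : a₂ * c₃ - c₂ * a₃ ≠ 0)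
    (e₀ : l₁ * a₁ ^ 4 + l₂ * a₂ ^ 4 + l₃ * a₃ ^ 4 = 0)
    (e₁ : l₁ * (a₁ ^ 3 * c₁) + l₂ * (a₂ ^ 3 * c₂) + l₃ * (a₃ ^ 3 * c₃) = 0)
    (e₃ : l₁ * (c₁ ^ 3 * a₁) + l₂ * (c₂ ^ 3 * a₂) + l₃ * (c₃ ^ 3 * a₃) = 0)
    (e₄ : l₁ * c₁ ^ 4 + l₂ * c₂ ^ 4 + l₃ * c₃ ^ 4 = 0) :
    a₁ ≠ 0 ∧ a₂ ≠ 0 ∧ a₃ ≠ 0 ∧ ∃ t z : ℂ, t ≠ 0 ∧ z ^ 2 + z + 1 = 0 ∧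
      c₁ = t * a₁ ∧ c₂ = z * t * a₂ ∧ c₃ = z ^ 2 * t * a₃ := by
  have k₁ : a₁ ≠ 0 := by
    rintro rfl
    have : (l₂ * (a₂ * c₃ - c₂ * a₃)) * a₂ ^ 3 = 0 := by linear_combination c₃ * e₀ - a₃ * e₁
    have := (mul_eq_zero.mp this).resolve_left (mul_ne_zero h₂ h₂₃)
    have := (pow_eq_zero_iff (three_ne_zero)).mp this
    exact h₁₂ (by rw [this]; ring)
  have k₂ : a₂ ≠ 0 := by
    rintro rfl
    have : (l₁ * (a₁ * c₃ - c₁ * a₃)) * a₁ ^ 3 = 0 := by linear_combination c₃ * e₀ - a₃ * e₁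
    have := (mul_eq_zero.mp this).resolve_left (mul_ne_zero h₁ h₁₃)
    exact k₁ ((pow_eq_zero_iff (three_ne_zero)).mp this)
  have k₃ : a₃ ≠ 0 := by
    rintro rfl
    have : (l₁ * (a₁ * c₂ - c₁ * a₂)) * a₁ ^ 3 = 0 := by linear_combination c₂ * e₀ - a₂ * e₁
    have := (mul_eq_zero.mp this).resolve_left (mul_ne_zero h₁ h₁₂)
    exact k₁ ((pow_eq_zero_iff (three_ne_zero)).mp this)
  refine ⟨k₁, k₂, k₃, ?_⟩
  obtain ⟨t₁, ht₁⟩ : ∃ t, c₁ = t * a₁ := ⟨c₁ / a₁, by field_simp⟩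
  obtain ⟨t₂, ht₂⟩ : ∃ t, c₂ = t * a₂ := ⟨c₂ / a₂, by field_simp⟩
  obtain ⟨t₃, ht₃⟩ : ∃ t, c₃ = t * a₃ := ⟨c₃ / a₃, by field_simp⟩
  subst ht₁ ht₂ ht₃
  have d₁₂ : t₁ - t₂ ≠ 0 := fun h => h₁₂ (by linear_combination -a₁ * a₂ * h)
  have d₁₃ : t₁ - t₃ ≠ 0 := fun h => h₁₃ (by linear_combination -a₁ * a₃ * h)
  obtain ⟨w₁, hw₁⟩ : ∃ w, w = l₁ * a₁ ^ 4 := ⟨_, rfl⟩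
  obtain ⟨w₂, hw₂⟩ : ∃ w, w = l₂ * a₂ ^ 4 := ⟨_, rfl⟩
  obtain ⟨w₃, hw₃⟩ : ∃ w, w = l₃ * a₃ ^ 4 := ⟨_, rfl⟩
  have hw0 : w₁ ≠ 0 := by rw [hw₁]; exact mul_ne_zero h₁ (pow_ne_zero _ k₁)
  have f₀ : w₁ + w₂ + w₃ = 0 := by rw [hw₁, hw₂, hw₃]; exact e₀
  have f₁ : w₁ * t₁ + w₂ * t₂ + w₃ * t₃ = 0 := by rw [hw₁, hw₂, hw₃]; linear_combination e₁
  have f₃ : w₁ * t₁ ^ 3 + w₂ * t₂ ^ 3 + w₃ * t₃ ^ 3 = 0 := by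
    rw [hw₁, hw₂, hw₃]; linear_combination e₃
  have f₄ : w₁ * t₁ ^ 4 + w₂ * t₂ ^ 4 + w₃ * t₃ ^ 4 = 0 := by
    rw [hw₁, hw₂, hw₃]; linear_combination e₄
  have hnz := mul_ne_zero hw0 (mul_ne_zero d₁₃ d₁₂)
  have g₁ : t₁ + t₂ + t₃ = 0 := by
    refine (mul_eq_zero.mp ?_).resolve_left hnz
    linear_combination f₃ - t₃ ^ 3 * f₀ - (t₂ ^ 2 + t₂ * t₃ + t₃ ^ 2) * (f₁ - t₃ * f₀)
  have g₂ : t₁ ^ 2 + t₂ ^ 2 + t₃ ^ 2 + t₁ * t₂ + t₁ * t₃ + t₂ * t₃ = 0 := by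
    refine (mul_eq_zero.mp ?_).resolve_left hnz
    linear_combination f₄ - t₃ ^ 4 * f₀
      - (t₂ ^ 3 + t₂ ^ 2 * t₃ + t₂ * t₃ ^ 2 + t₃ ^ 3) * (f₁ - t₃ * f₀)
  obtain rfl : t₃ = -t₁ - t₂ := by linear_combination g₁
  have ht : t₁ ≠ 0 := by
    rintro rfl
    have : t₂ ^ 2 = 0 := by linear_combination g₂
    exact d₁₂ (by rw [(pow_eq_zero_iff two_ne_zero).mp this]; ring)
  have hz : (t₂ / t₁) ^ 2 + t₂ / t₁ + 1 = 0 := by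
    field_simp; linear_combination g₂
  refine ⟨t₁, t₂ / t₁, ht, hz, rfl, by field_simp, ?_⟩
  field_simp
  linear_combination -g₂

/-- The cousin relation for families of functions of two variables. -/
def FunCousin (φ ψ : Fin 4 → ℂ → ℂ → ℂ) : Prop :=
  ∃ (a b c d : ℂ) (π : Equiv.Perm (Fin 4)) (cs : Fin 4 → ℂ),
    a * d - b * c ≠ 0 ∧ (∀ j, cs j ≠ 0) ∧
    ∀ j x y, φ j x y = cs j * ψ (π j) (a * x + b * y) (c * x + d * y)

lemma FunCousin.trans {φ ψ χ : Fin 4 → ℂ → ℂ → ℂ} (h₁ : FunCousin φ ψ) (h₂ : FunCousin ψ χ) :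
    FunCousin φ χ := by
  obtain ⟨a, b, c, d, π, cs, hM, hcs, h⟩ := h₁
  obtain ⟨a', b', c', d', π', cs', hM', hcs', h'⟩ := h₂
  refine ⟨a' * a + b' * c, a' * b + b' * d, c' * a + d' * c, c' * b + d' * d, π.trans π',
    fun j => cs j * cs' (π j), ?_, fun j => mul_ne_zero (hcs j) (hcs' _), fun j x y => ?_⟩
  · have := mul_ne_zero hM hM'
    contrapose! this
    linear_combination this
  · rw [h, h', Equiv.trans_apply, mul_assoc]
    congr 3 <;> ring

lemma FunCousin.symm {φ ψ : Fin 4 → ℂ → ℂ → ℂ} (h₁ : FunCousin φ ψ) : FunCousin ψ φ := by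
  obtain ⟨a, b, c, d, π, cs, hM, hcs, h⟩ := h₁
  refine ⟨d / (a * d - b * c), -b / (a * d - b * c), -c / (a * d - b * c), a / (a * d - b * c),
    π.symm, fun j => (cs (π.symm j))⁻¹, ?_, fun j => inv_ne_zero (hcs _), fun j x y => ?_⟩
  · have e : d / (a * d - b * c) * (a / (a * d - b * c)) -
      -b / (a * d - b * c) * (-c / (a * d - b * c)) = (a * d - b * c)⁻¹ := by
      rw [div_mul_div_comm, div_mul_div_comm, ← sub_div, div_eq_iff (mul_ne_zero hM hM),
        inv_mul_cancel_left₀ hM]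
      ring
    rw [e]
    exact inv_ne_zero hM
  · rw [h, Equiv.apply_symm_apply, inv_mul_cancel_left₀ (hcs _)]
    have e₁ : a * (d / (a * d - b * c) * x + -b / (a * d - b * c) * y) +
        b * (-c / (a * d - b * c) * x + a / (a * d - b * c) * y) = x := by
      rw [show a * (d / (a * d - b * c) * x + -b / (a * d - b * c) * y) +
        b * (-c / (a * d - b * c) * x + a / (a * d - b * c) * y) =
          (a * d - b * c) * x / (a * d - b * c) by ring, mul_div_cancel_left₀ _ hM]
    have e₂ : c * (d / (a * d - b * c) * x + -b / (a * d - b * c) * y) +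
        d * (-c / (a * d - b * c) * x + a / (a * d - b * c) * y) = y := by
      rw [show c * (d / (a * d - b * c) * x + -b / (a * d - b * c) * y) +
        d * (-c / (a * d - b * c) * x + a / (a * d - b * c) * y) =
          (a * d - b * c) * y / (a * d - b * c) by ring, mul_div_cancel_left₀ _ hM]
    rw [e₁, e₂]

/-- Evaluation of a bivariate polynomial as a function of two variables. -/
noncomputable def evalFun (p : MvPolynomial (Fin 2) ℂ) (x y : ℂ) : ℂ := eval ![x, y] p

lemma evalFun_linChange (a b c d : ℂ) (p : MvPolynomial (Fin 2) ℂ) (x y : ℂ) :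
    evalFun (linChange a b c d p) x y = evalFun p (a * x + b * y) (c * x + d * y) := by
  unfold evalFun linChange
  rw [map_aeval]
  have : (eval ![x, y]).comp (algebraMap ℂ (MvPolynomial (Fin 2) ℂ)) = RingHom.id ℂ := by
    ext; simp
  rw [this]
  change eval _ p = _
  congr 2
  ext i
  fin_cases i <;> simp [Px, Py]

lemma evalFun_injective {p q : MvPolynomial (Fin 2) ℂ} (h : ∀ x y, evalFun p x y = evalFun q x y) :
    p = q := by
  apply MvPolynomial.funext
  intro v
  have : v = ![v 0, v 1] := by ext i; fin_cases i <;> rfl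
  rw [this]
  exact h _ _

lemma FunCousin.cousin {f g : Fin 4 → MvPolynomial (Fin 2) ℂ}
    (h : FunCousin (fun i => evalFun (f i)) (fun i => evalFun (g i))) : Cousin f g := by
  obtain ⟨a, b, c, d, π, cs, hM, hcs, h⟩ := h
  refine ⟨a, b, c, d, π, cs, hM, hcs, fun j => evalFun_injective fun x y => ?_⟩
  refine (h j x y).trans ?_
  simp only [← evalFun_linChange]
  simp [evalFun]

lemma evalFun_of_isHomogeneous {p : MvPolynomial (Fin 2) ℂ} (hp : p.IsHomogeneous 2) :
    ∃ a b c : ℂ, ∀ x y, evalFun p x y = a * x ^ 2 + b * x * y + c * y ^ 2 := by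
  obtain ⟨d, hd⟩ : ∃ d : Fin 3 → (Fin 2 →₀ ℕ),
      d = fun k : Fin 3 => Finsupp.single 0 (2 - k.val) + Finsupp.single 1 k.val := ⟨_, rfl⟩
  have hinj : Function.Injective d := by
    intro k l hkl
    have := DFunLike.congr_fun hkl 1
    simp [hd] at this
    exact Fin.ext this
  refine ⟨coeff (d 0) p, coeff (d 1) p, coeff (d 2) p, fun x y => ?_⟩
  have hsub : p.support ⊆ univ.image d := by
    intro e he
    have h2 := hp (mem_support_iff.mp he)
    rw [Finsupp.weight_apply, Finsupp.sum_fintype _ _ (by simp)] at h2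
    simp at h2
    refine mem_image.mpr ⟨⟨e 1, by omega⟩, mem_univ _, ?_⟩
    ext i
    fin_cases i <;> simp [hd]
    omega
  rw [evalFun, eval_eq', Finset.sum_subset hsub
    (fun e _ he => by rw [notMem_support_iff.mp he, zero_mul]),
    Finset.sum_image (fun _ _ _ _ h => hinj h)]
  simp [Fin.sum_univ_three, hd]
  ring

/-- Four pairwise non-proportional binary quadratics with a linear and a quartic relation. -/
structure DependentQuadratics (φ : Fin 4 → ℂ → ℂ → ℂ) (l h : Fin 4 → ℂ) : Prop where
  quad : ∀ i, ∃ a b c : ℂ, ∀ x y, φ i x y = a * x ^ 2 + b * x * y + c * y ^ 2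
  not_proportional : ∀ i j, i ≠ j → ∀ k : ℂ, ¬ ∀ x y, φ i x y = k * φ j x y
  coeff_ne : ∀ i, l i ≠ 0
  quartic : ∀ x y, ∑ i, l i * φ i x y ^ 4 = 0
  linear : ∀ x y, ∑ i, h i * φ i x y = 0

/-- Dependent quadratics are preserved by a change of coordinates, permutation and scaling. -/
lemma DependentQuadratics.transform {φ : Fin 4 → ℂ → ℂ → ℂ} {l h : Fin 4 → ℂ}
    (H : DependentQuadratics φ l h) {a b c d : ℂ} (hM : a * d - b * c ≠ 0)
    (π : Equiv.Perm (Fin 4)) {cs : Fin 4 → ℂ} (hcs : ∀ j, cs j ≠ 0) :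
    DependentQuadratics (fun j x y => cs j * φ (π j) (a * x + b * y) (c * x + d * y))
      (fun j => l (π j) / cs j ^ 4) (fun j => h (π j) / cs j) := by
  refine ⟨fun i => ?_, fun i j hij k hk => ?_, fun i => ?_, fun x y => ?_, fun x y => ?_⟩
  · obtain ⟨p, q, r, hpqr⟩ := H.quad (π i)
    refine ⟨cs i * (p * a ^ 2 + q * a * c + r * c ^ 2),
      cs i * (2 * p * a * b + q * (a * d + b * c) + 2 * r * c * d),
      cs i * (p * b ^ 2 + q * b * d + r * d ^ 2), fun x y => ?_⟩
    rw [hpqr]; ring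
  · refine H.not_proportional (π i) (π j) (π.injective.ne hij) (k * cs j / cs i) fun x y => ?_
    have := hk ((d * x - b * y) / (a * d - b * c)) ((a * y - c * x) / (a * d - b * c))
    have e1 : a * ((d * x - b * y) / (a * d - b * c)) + b * ((a * y - c * x) / (a * d - b * c))
        = x := by
      rw [mul_div_assoc', mul_div_assoc', ← add_div, div_eq_iff hM]; ring
    have e2 : c * ((d * x - b * y) / (a * d - b * c)) + d * ((a * y - c * x) / (a * d - b * c))
        = y := by
      rw [mul_div_assoc', mul_div_assoc', ← add_div, div_eq_iff hM]; ring
    rw [e1, e2] at this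
    rw [div_mul_eq_mul_div, eq_div_iff (hcs i)]
    linear_combination this
  · exact div_ne_zero (H.coeff_ne _) (pow_ne_zero _ (hcs i))
  · rw [← H.quartic (a * x + b * y) (c * x + d * y),
      ← Equiv.sum_comp π (fun i => l i * φ i (a * x + b * y) (c * x + d * y) ^ 4)]
    refine Finset.sum_congr rfl fun j _ => ?_
    have := hcs j
    field_simp
  · rw [← H.linear (a * x + b * y) (c * x + d * y),
      ← Equiv.sum_comp π (fun i => h i * φ i (a * x + b * y) (c * x + d * y))]
    refine Finset.sum_congr rfl fun j _ => ?_
    have := hcs j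
    field_simp

lemma funCousin_transform (φ : Fin 4 → ℂ → ℂ → ℂ) {a b c d : ℂ} (hM : a * d - b * c ≠ 0)
    (π : Equiv.Perm (Fin 4)) {cs : Fin 4 → ℂ} (hcs : ∀ j, cs j ≠ 0) :
    FunCousin φ (fun j x y => cs j * φ (π j) (a * x + b * y) (c * x + d * y)) :=
  FunCousin.symm ⟨a, b, c, d, π, cs, hM, hcs, fun _ _ _ => rfl⟩

/-- The coefficient vectors of non-proportional quadratics are independent. -/
lemma DependentQuadratics.minors {φ : Fin 4 → ℂ → ℂ → ℂ} {l h : Fin 4 → ℂ}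
    (H : DependentQuadratics φ l h) {a b c : Fin 4 → ℂ}
    (hφ : ∀ i x y, φ i x y = a i * x ^ 2 + b i * x * y + c i * y ^ 2) {i j : Fin 4} (hij : i ≠ j) :
    ¬ (a i * b j = b i * a j ∧ a i * c j = c i * a j ∧ b i * c j = c i * b j) := by
  rintro ⟨h1, h2, h3⟩
  by_cases ha : a j = 0
  · by_cases hb : b j = 0
    · by_cases hc : c j = 0
      · exact H.not_proportional j i hij.symm 0 fun x y => by rw [hφ, ha, hb, hc]; ring
      · refine H.not_proportional i j hij (c i / c j) fun x y => ?_
        rw [hφ, hφ, div_mul_eq_mul_div, eq_div_iff hc]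
        linear_combination x ^ 2 * h2 + x * y * h3
    · refine H.not_proportional i j hij (b i / b j) fun x y => ?_
      rw [hφ, hφ, div_mul_eq_mul_div, eq_div_iff hb]
      linear_combination x ^ 2 * h1 - y ^ 2 * h3
  · refine H.not_proportional i j hij (a i / a j) fun x y => ?_
    rw [hφ, hφ, div_mul_eq_mul_div, eq_div_iff ha]
    linear_combination - x * y * h1 - y ^ 2 * h2

/-- A nonzero binary quadratic is equivalent to `x * y` or to `x ^ 2`. -/
lemma exists_quadratic_normal_form {p q r : ℂ} (hne : ¬ (p = 0 ∧ q = 0 ∧ r = 0)) :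
    ∃ a b c d : ℂ, a * d - b * c ≠ 0 ∧
      ((∀ x y, p * (a * x + b * y) ^ 2 + q * (a * x + b * y) * (c * x + d * y)
        + r * (c * x + d * y) ^ 2 = x * y) ∨
       (∀ x y, p * (a * x + b * y) ^ 2 + q * (a * x + b * y) * (c * x + d * y)
        + r * (c * x + d * y) ^ 2 = x ^ 2)) := by
  by_cases hp : p = 0
  · by_cases hq : q = 0
    · have hr : r ≠ 0 := fun h => hne ⟨hp, hq, h⟩
      obtain ⟨z, hz⟩ := IsAlgClosed.exists_pow_nat_eq r (n := 2) (by norm_num)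
      have hz0 : z ≠ 0 := by rintro rfl; exact hr (by rw [← hz]; norm_num)
      refine ⟨0, 1, 1 / z, 0, by simpa using hz0, Or.inr fun x y => ?_⟩
      rw [hp, hq, ← hz]; field_simp; ring
    · refine ⟨1 / q, -r / q, 0, 1, by simpa using hq, Or.inl fun x y => ?_⟩
      rw [hp]; field_simp; ring
  · obtain ⟨δ, hδ⟩ := IsAlgClosed.exists_pow_nat_eq (q ^ 2 - 4 * p * r) (n := 2) (by norm_num)
    by_cases hδ0 : δ = 0
    · obtain ⟨z, hz⟩ := IsAlgClosed.exists_pow_nat_eq p (n := 2) (by norm_num)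
      have hz0 : z ≠ 0 := by rintro rfl; exact hp (by rw [← hz]; norm_num)
      refine ⟨1 / z, -q / (2 * p), 0, 1, by simpa using hz0, Or.inr fun x y => ?_⟩
      have hr : r = q ^ 2 / (4 * p) := by
        rw [hδ0] at hδ; field_simp; linear_combination hδ
      rw [hr, ← hz]; field_simp; ring
    · refine ⟨(q + δ) / (2 * p * δ), 1 - (q + δ) / (2 * δ), -1 / δ, p / δ, ?_, Or.inl fun x y => ?_⟩
      · have : (q + δ) / (2 * p * δ) * (p / δ) - (1 - (q + δ) / (2 * δ)) * (-1 / δ) = 1 / δ := by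
          field_simp; ring
        rw [this]
        exact one_div_ne_zero hδ0
      · have hr : r = (q ^ 2 - δ ^ 2) / (4 * p) := by
          field_simp; linear_combination hδ
        rw [hr]; field_simp; ring

lemma omega_sq_add_omega_add_one : omega ^ 2 + omega + 1 = 0 := by
  have h : IsPrimitiveRoot omega 3 := by
    have := Complex.isPrimitiveRoot_exp 3 (by norm_num)
    rw [omega]
    exact_mod_cast this
  have h1 : omega ≠ 1 := h.ne_one (by norm_num)
  apply mul_left_cancel₀ (sub_ne_zero.mpr h1)
  linear_combination h.pow_eq_one

lemma omega_pow_three : omega ^ 3 = 1 := by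
  linear_combination (omega - 1) * omega_sq_add_omega_add_one

lemma DependentQuadratics.eq_zero_of_two_term {φ : Fin 4 → ℂ → ℂ → ℂ} {l h : Fin 4 → ℂ}
    (H : DependentQuadratics φ l h) {i j : Fin 4} (hij : i ≠ j) {p q : ℂ}
    (hpq : ∀ x y, p * φ i x y + q * φ j x y = 0) : p = 0 ∧ q = 0 := by
  have key : ∀ {i j : Fin 4}, i ≠ j → ∀ {p q : ℂ},
      (∀ x y, p * φ i x y + q * φ j x y = 0) → p = 0 := by
    intro i j hij p q hpq
    by_contra hp
    refine H.not_proportional i j hij (-q / p) fun x y => ?_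
    rw [div_mul_eq_mul_div, eq_div_iff hp]
    linear_combination hpq x y
  exact ⟨key hij hpq, key hij.symm fun x y => by rw [add_comm]; exact hpq x y⟩

/-- If the last coefficient of the linear relation vanishes then the other ones do not. -/
lemma DependentQuadratics.linear_coeff_ne_zero {φ : Fin 4 → ℂ → ℂ → ℂ} {l h : Fin 4 → ℂ}
    (H : DependentQuadratics φ l h) (h3 : h 3 = 0) (hh : h ≠ 0) : h 0 ≠ 0 ∧ h 1 ≠ 0 ∧ h 2 ≠ 0 := by
  have hl := H.linear
  simp only [Fin.sum_univ_four, h3, zero_mul, add_zero] at hl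
  refine ⟨fun h0 => hh ?_, fun h1 => hh ?_, fun h2 => hh ?_⟩
  · obtain ⟨h1, h2⟩ := H.eq_zero_of_two_term (i := 1) (j := 2) (by decide)
      (fun x y => by simpa [h0] using hl x y)
    ext i; fin_cases i <;> simp [*]
  · obtain ⟨h0, h2⟩ := H.eq_zero_of_two_term (i := 0) (j := 2) (by decide)
      (fun x y => by simpa [h1] using hl x y)
    ext i; fin_cases i <;> simp [*]
  · obtain ⟨h0, h1⟩ := H.eq_zero_of_two_term (i := 0) (j := 1) (by decide)
      (fun x y => by simpa [h2] using hl x y)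
    ext i; fin_cases i <;> simp [*]

lemma quadratic_coeff_eq {a b c a' b' c' : ℂ}
    (h : ∀ x y : ℂ, a * x ^ 2 + b * x * y + c * y ^ 2 = a' * x ^ 2 + b' * x * y + c' * y ^ 2) :
    a = a' ∧ b = b' ∧ c = c' := by
  have h1 := h 1 0
  have h2 := h 0 1
  have h3 := h 1 1
  refine ⟨by linear_combination h1, by linear_combination h3 - h1 - h2, by linear_combination h2⟩

lemma DependentQuadratics.third_coeff {φ : Fin 4 → ℂ → ℂ → ℂ} {l h : Fin 4 → ℂ}
    (H : DependentQuadratics φ l h) (h3 : h 3 = 0) (hh : h ≠ 0) {a b c : Fin 4 → ℂ}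
    (hφ : ∀ i x y, φ i x y = a i * x ^ 2 + b i * x * y + c i * y ^ 2) :
    ∃ u v : ℂ, u ≠ 0 ∧ v ≠ 0 ∧ a 2 = u * a 0 + v * a 1 ∧ b 2 = u * b 0 + v * b 1 ∧
      c 2 = u * c 0 + v * c 1 := by
  obtain ⟨h0, h1, h2⟩ := H.linear_coeff_ne_zero h3 hh
  refine ⟨-h 0 / h 2, -h 1 / h 2, div_ne_zero (neg_ne_zero.mpr h0) h2,
    div_ne_zero (neg_ne_zero.mpr h1) h2, ?_⟩
  apply quadratic_coeff_eq
  intro x y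
  have hl := H.linear x y
  simp only [Fin.sum_univ_four, h3, zero_mul, add_zero, hφ] at hl
  field_simp
  linear_combination hl

lemma DependentQuadratics.ne_sq {φ : Fin 4 → ℂ → ℂ → ℂ} {l h : Fin 4 → ℂ}
    (H : DependentQuadratics φ l h) (h3 : h 3 = 0) (hh : h ≠ 0) :
    ¬ ∀ x y, φ 3 x y = x ^ 2 := by
  intro hφ3
  choose a b c hφ using H.quad
  obtain ⟨u, v, hu, hv, ha, hb, hc⟩ := H.third_coeff h3 hh hφ
  obtain ⟨a3, b3, c3⟩ := quadratic_coeff_eq (a := a 3) (b := b 3) (c := c 3) (a' := 1) (b' := 0)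
    (c' := 0) fun x y => by rw [← hφ, hφ3]; ring
  obtain ⟨r0, r1, r2, r3, r4⟩ := coeff_relations l a b c
    (fun x => by simpa [hφ] using H.quartic x 1)
  obtain ⟨m0, m1, m2, m3, m4⟩ := coeff_relations l c b a
    (fun x => by
      rw [← H.quartic 1 x]
      refine Finset.sum_congr rfl fun i _ => ?_
      rw [hφ]; ring)
  simp only [Fin.sum_univ_four, a3, b3, c3] at *
  refine pencil_not_eighth_power (H.coeff_ne 0) (H.coeff_ne 1) (l₃ := l 2) hu hv ha hb hc
    (H.minors hφ (by decide)) ?_ ?_ ?_ ?_ ?_ ?_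
  · linear_combination r0
  · linear_combination r1
  · linear_combination r2
  · linear_combination r4
  · linear_combination m3
  · linear_combination m2

lemma DependentQuadratics.funCousin_of_eq_mul {φ : Fin 4 → ℂ → ℂ → ℂ} {l h : Fin 4 → ℂ}
    (H : DependentQuadratics φ l h) (h3 : h 3 = 0) (hh : h ≠ 0)
    (hφ3 : ∀ x y, φ 3 x y = x * y) : FunCousin φ (fun i => evalFun (quartForm i)) := by
  choose a b c hφ using H.quad
  obtain ⟨u, v, hu, hv, ha, hb, hc⟩ := H.third_coeff h3 hh hφ
  obtain ⟨a3, b3, c3⟩ := quadratic_coeff_eq (a := a 3) (b := b 3) (c := c 3) (a' := 0) (b' := 1)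
    (c' := 0) fun x y => by rw [← hφ, hφ3]; ring
  obtain ⟨r0, r1, r2, r3, r4⟩ := coeff_relations l a b c
    (fun x => by simpa [hφ] using H.quartic x 1)
  obtain ⟨m0, m1, m2, m3, m4⟩ := coeff_relations l c b a
    (fun x => by
      rw [← H.quartic 1 x]
      refine Finset.sum_congr rfl fun i _ => ?_
      rw [hφ]; ring)
  simp only [Fin.sum_univ_four, a3, b3, c3] at r0 r1 r2 r3 r4 m0 m1 m2 m3 m4
  have p1 := pencil_square (H.coeff_ne 0) (H.coeff_ne 1) (l₃ := l 2) hu hv ha hb hc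
    (by linear_combination r0) (by linear_combination r1) (by linear_combination r2)
  have p2 := pencil_square (H.coeff_ne 0) (H.coeff_ne 1) (l₃ := l 2) hu hv hc hb ha
    (by linear_combination m0) (by linear_combination m1) (by linear_combination m2)
  have h01 := H.minors hφ (i := 0) (j := 1) (by decide)
  have h02 := H.minors hφ (i := 0) (j := 2) (by decide)
  have h12 := H.minors hφ (i := 1) (j := 2) (by decide)
  have d01 : a 0 * c 1 - c 0 * a 1 ≠ 0 := fun h =>
    h01 ⟨by linear_combination p2, by linear_combination h, by linear_combination - p1⟩
  have b0 : b 0 = 0 := by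
    apply (mul_eq_zero.mp (show b 0 * (a 0 * c 1 - c 0 * a 1) = 0 by
      linear_combination - a 0 * p1 + c 0 * p2)).resolve_right d01
  have b1 : b 1 = 0 := by
    apply (mul_eq_zero.mp (show b 1 * (a 0 * c 1 - c 0 * a 1) = 0 by
      linear_combination - a 1 * p1 + c 1 * p2)).resolve_right d01
  have b2 : b 2 = 0 := by rw [hb, b0, b1]; ring
  have d02 : a 0 * c 2 - c 0 * a 2 ≠ 0 := fun h =>
    h02 ⟨by rw [b0, b2]; ring, by linear_combination h, by rw [b0, b2]; ring⟩
  have d12 : a 1 * c 2 - c 1 * a 2 ≠ 0 := fun h =>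
    h12 ⟨by rw [b1, b2]; ring, by linear_combination h, by rw [b1, b2]; ring⟩
  obtain ⟨a0, a1, a2, t, z, ht, hz, e0, e1, e2⟩ := three_fourth_powers (l₁ := l 0) (l₂ := l 1)
    (l₃ := l 2) (a₁ := a 0) (a₂ := a 1) (a₃ := a 2) (c₁ := c 0) (c₂ := c 1) (c₃ := c 2)
    (H.coeff_ne 0) (H.coeff_ne 1) d01 d02 d12 (by linear_combination m0)
    (by linear_combination m2 / 2 - (3 / 2) * (l 0 * a 0 ^ 2 * b 0 * b0 + l 1 * a 1 ^ 2 * b 1 * b1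
      + l 2 * a 2 ^ 2 * b 2 * b2))
    (by linear_combination r2 / 2 - (3 / 2) * (l 0 * c 0 ^ 2 * b 0 * b0 + l 1 * c 1 ^ 2 * b 1 * b1
      + l 2 * c 2 ^ 2 * b 2 * b2)) (by linear_combination r0)
  obtain ⟨τ, hτ⟩ := IsAlgClosed.exists_pow_nat_eq t (n := 2) (by norm_num)
  have hτ0 : τ ≠ 0 := by rintro rfl; exact ht (by rw [← hτ]; norm_num)
  have hω := omega_sq_add_omega_add_one
  have hω0 : omega ≠ 0 := fun h => by rw [h] at hω; norm_num at hω
  have hzω : (z - omega) * (z - omega ^ 2) = 0 := by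
    linear_combination hz + (omega - 1 - z) * hω
  rcases mul_eq_zero.mp hzω with hz' | hz'
  · rw [sub_eq_zero.mp hz'] at e1 e2
    refine ⟨1, 0, 0, τ, 1, ![a 0, a 1 * omega ^ 2, a 2 * omega, 1 / τ], by simpa using hτ0, ?_, ?_⟩
    · intro j; fin_cases j <;> simp [a0, a1, a2, hω0, hτ0]
    · intro j x y
      fin_cases j <;>
        simp [hφ, evalFun, quartForm, Px, Py, a3, b0, b1, b2, b3, c3, e0, e1, e2, ← hτ]
      · ring
      · linear_combination (-a 1 * (x ^ 2 + omega * τ ^ 2 * y ^ 2)) * omega_pow_three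
      · linear_combination (-a 2 * (x ^ 2)) * omega_pow_three
      · field_simp
  · rw [sub_eq_zero.mp hz'] at e1 e2
    refine ⟨1, 0, 0, τ, Equiv.swap 1 2, ![a 0, a 1 * omega, a 2 * omega ^ 2, 1 / τ],
      by simpa using hτ0, ?_, ?_⟩
    · intro j; fin_cases j <;> simp [a0, a1, a2, hω0, hτ0]
    · intro j x y
      have s0 : (Equiv.swap 1 2 : Equiv.Perm (Fin 4)) 0 = 0 := by decide
      have s3 : (Equiv.swap 1 2 : Equiv.Perm (Fin 4)) 3 = 3 := by decide
      fin_cases j <;>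
        simp [hφ, evalFun, quartForm, Px, Py, a3, b0, b1, b2, b3, c3, e0, e1, e2, ← hτ, s0, s3]
      · ring
      · linear_combination (-a 1 * (x ^ 2)) * omega_pow_three
      · linear_combination (-a 2 * (x ^ 2)) * omega_pow_three
      · field_simp

lemma DependentQuadratics.exists_normal_form {φ : Fin 4 → ℂ → ℂ → ℂ} {l h : Fin 4 → ℂ}
    (H : DependentQuadratics φ l h) (i : Fin 4) :
    ∃ a b c d : ℂ, a * d - b * c ≠ 0 ∧
      ((∀ x y, φ i (a * x + b * y) (c * x + d * y) = x * y) ∨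
       (∀ x y, φ i (a * x + b * y) (c * x + d * y) = x ^ 2)) := by
  obtain ⟨p, q, r, hφ⟩ := H.quad i
  obtain ⟨j, hj⟩ := exists_ne i
  simp only [hφ]
  apply exists_quadratic_normal_form
  rintro ⟨rfl, rfl, rfl⟩
  exact H.not_proportional i j hj.symm 0 fun x y => by rw [hφ]; ring

/-- If three of the four quadratics are linearly dependent, the family is a cousin of the
first model. -/
lemma DependentQuadratics.funCousin_of_eq_zero {φ : Fin 4 → ℂ → ℂ → ℂ} {l h : Fin 4 → ℂ}
    (H : DependentQuadratics φ l h) {i : Fin 4} (hi : h i = 0) (hh : h ≠ 0) :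
    FunCousin φ (fun i => evalFun (quartForm i)) := by
  obtain ⟨a, b, c, d, hM, hnf⟩ := H.exists_normal_form i
  have H' := H.transform hM (Equiv.swap i 3) (cs := 1) (fun _ => one_ne_zero)
  have h3 : h (Equiv.swap i 3 3) / (1 : Fin 4 → ℂ) 3 = 0 := by simp [hi]
  have hh' : (fun j => h (Equiv.swap i 3 j) / (1 : Fin 4 → ℂ) j) ≠ 0 := by
    intro h0
    apply hh
    ext j
    simpa using congrFun h0 (Equiv.swap i 3 j)
  rcases hnf with hnf | hnf
  · exact (funCousin_transform φ hM (Equiv.swap i 3) (cs := 1) (fun _ => one_ne_zero)).trans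
      (H'.funCousin_of_eq_mul h3 hh' (by simpa using hnf))
  · exact (H'.ne_sq h3 hh' (by simpa using hnf)).elim

lemma sqrt_three_sq : ((Real.sqrt 3 : ℝ) : ℂ) ^ 2 = 3 := by
  rw [← Complex.ofReal_pow, Real.sq_sqrt (by norm_num)]
  norm_num

lemma evalFun_quartForm' (x y : ℂ) :
    evalFun (quartForm' 0) x y = x ^ 2 + (Real.sqrt 3 : ℝ) * x * y - y ^ 2 ∧
    evalFun (quartForm' 1) x y = x ^ 2 - (Real.sqrt 3 : ℝ) * x * y - y ^ 2 ∧
    evalFun (quartForm' 2) x y = (omega ^ 2 * x) ^ 2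
      + (Real.sqrt 3 : ℝ) * (omega ^ 2 * x) * (omega * y) - (omega * y) ^ 2 ∧
    evalFun (quartForm' 3) x y = (omega ^ 2 * x) ^ 2
      - (Real.sqrt 3 : ℝ) * (omega ^ 2 * x) * (omega * y) - (omega * y) ^ 2 := by
  refine ⟨?_, ?_, ?_, ?_⟩
  · simp [evalFun, quartForm', Px, Py]
  · simp [evalFun, quartForm', Px, Py]
  · refine (evalFun_linChange _ _ _ _ _ _ _).trans ?_
    simp [evalFun, Px, Py]
  · refine (evalFun_linChange _ _ _ _ _ _ _).trans ?_
    simp [evalFun, Px, Py]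

lemma quartForm'_fourth_powers_dependent :
    ¬ LinearIndependent ℂ (fun j : Fin 4 => quartForm' ((![0, 1, 2, 3] : Fin 4 → Fin 6) j) ^ 4) := by
  rw [Fintype.not_linearIndependent_iff]
  refine ⟨![1, -1, -1, 1], ?_, 0, by simp⟩
  apply evalFun_injective
  intro x y
  have key : ∀ x y : ℂ, (x ^ 2 + (Real.sqrt 3 : ℝ) * x * y - y ^ 2) ^ 4
      - (x ^ 2 - (Real.sqrt 3 : ℝ) * x * y - y ^ 2) ^ 4
      = 8 * (Real.sqrt 3 : ℝ) * (x * y * (x ^ 6 - y ^ 6)) := fun x y => by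
    linear_combination (8 * (Real.sqrt 3 : ℝ) * x ^ 3 * y ^ 3 * (x ^ 2 - y ^ 2)) * sqrt_three_sq
  have e : ∀ j, evalFun (quartForm' j ^ 4) x y = evalFun (quartForm' j) x y ^ 4 :=
    fun j => by simp [evalFun]
  have e15 : omega ^ 15 = 1 := by
    rw [show omega ^ 15 = (omega ^ 3) ^ 5 by ring, omega_pow_three, one_pow]
  have e9 : omega ^ 9 = 1 := by
    rw [show omega ^ 9 = (omega ^ 3) ^ 3 by ring, omega_pow_three, one_pow]
  obtain ⟨h0, h1, h2, h3⟩ := evalFun_quartForm' x y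
  have : evalFun (quartForm' 0 ^ 4 - quartForm' 1 ^ 4 - quartForm' 2 ^ 4 + quartForm' 3 ^ 4) x y
      = 0 := by
    have k1 := key x y
    have k2 := key (omega ^ 2 * x) (omega * y)
    rw [← h0, ← h1] at k1
    rw [← h2, ← h3] at k2
    have : evalFun (quartForm' 0 ^ 4 - quartForm' 1 ^ 4 - quartForm' 2 ^ 4 + quartForm' 3 ^ 4) x y
      = evalFun (quartForm' 0) x y ^ 4 - evalFun (quartForm' 1) x y ^ 4
        - evalFun (quartForm' 2) x y ^ 4 + evalFun (quartForm' 3) x y ^ 4 := by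
      simp [evalFun]
    rw [this]
    linear_combination k1 - k2 - 8 * (Real.sqrt 3 : ℝ) * x ^ 7 * y * e15
      + 8 * (Real.sqrt 3 : ℝ) * x * y ^ 7 * e9
  rw [Fin.sum_univ_four]
  simpa [evalFun, sub_eq_add_neg] using this

/-- The sum and difference parametrisation of the two pairs satisfies a cubic norm equation. -/
lemma DependentQuadratics.norm_equation {φ : Fin 4 → ℂ → ℂ → ℂ}
    (H : DependentQuadratics φ ![1, -1, -1, 1] ![1, -1, -1, 1]) (x y : ℂ) :
    (φ 0 x y + φ 1 x y) ^ 2 + (φ 0 x y + φ 1 x y) * (φ 2 x y + φ 3 x y)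
      + (φ 2 x y + φ 3 x y) ^ 2 + (φ 0 x y - φ 1 x y) ^ 2 = 0 := by
  have hP : ∀ i, ∃ p : MvPolynomial (Fin 2) ℂ, ∀ x y, φ i x y = evalFun p x y := fun i => by
    obtain ⟨a, b, c, h⟩ := H.quad i
    exact ⟨C a * X 0 ^ 2 + C b * X 0 * X 1 + C c * X 1 ^ 2, fun x y => by simp [h, evalFun]⟩
  choose P hP using hP
  have hl : P 0 - P 1 - P 2 + P 3 = 0 := evalFun_injective fun x y => by
    have := H.linear x y
    simp only [Fin.sum_univ_four, hP] at this
    simp [evalFun] at this ⊢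
    linear_combination this
  have hq : P 0 ^ 4 - P 1 ^ 4 - P 2 ^ 4 + P 3 ^ 4 = 0 := evalFun_injective fun x y => by
    have := H.quartic x y
    simp only [Fin.sum_univ_four, hP] at this
    simp [evalFun] at this ⊢
    linear_combination this
  have hne : ∀ i j, i ≠ j → P i - P j ≠ 0 := fun i j hij h0 =>
    H.not_proportional i j hij 1 fun x y => by rw [hP, hP, sub_eq_zero.mp h0, one_mul]
  have key : (P 0 - P 1) * (2 * (P 0 - P 2) *
      ((P 0 + P 1) ^ 2 + (P 0 + P 1) * (P 2 + P 3) + (P 2 + P 3) ^ 2 + (P 0 - P 1) ^ 2)) = 0 := by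
    have h3 : P 3 = P 1 + P 2 - P 0 := by linear_combination hl
    rw [h3] at hq ⊢
    linear_combination 2 * hq
  have h2 : (2 : MvPolynomial (Fin 2) ℂ) * (P 0 - P 2) ≠ 0 :=
    mul_ne_zero two_ne_zero (hne 0 2 (by decide))
  have := ((mul_eq_zero.mp key).resolve_left (hne 0 1 (by decide)))
  have := (mul_eq_zero.mp this).resolve_left h2
  have := congrArg (fun p => evalFun p x y) this
  simp only [hP]
  simpa [evalFun] using this

lemma quartic_coeff_eq_zero {a b c d e : ℂ}
    (h : ∀ x : ℂ, a * x ^ 4 + b * x ^ 3 + c * x ^ 2 + d * x + e = 0) :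
    a = 0 ∧ b = 0 ∧ c = 0 ∧ d = 0 ∧ e = 0 := by
  have h0 := h 0
  have h1 := h 1
  have h2 := h (-1)
  have h3 := h 2
  have h4 := h (-2)
  refine ⟨?_, ?_, ?_, ?_, ?_⟩
  · linear_combination (1 / 4) * h0 - (1 / 6) * h1 - (1 / 6) * h2 + (1 / 24) * h3 + (1 / 24) * h4
  · linear_combination -(1 / 6) * h1 + (1 / 6) * h2 + (1 / 12) * h3 - (1 / 12) * h4
  · linear_combination -(5 / 4) * h0 + (2 / 3) * h1 + (2 / 3) * h2 - (1 / 24) * h3 - (1 / 24) * h4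
  · linear_combination (2 / 3) * h1 - (2 / 3) * h2 - (1 / 12) * h3 + (1 / 12) * h4
  · linear_combination h0

lemma quadratic_mul_eq_neg_fourth_power {p q r p' q' r' : ℂ}
    (h : ∀ x y : ℂ, (p * x ^ 2 + q * x * y + r * y ^ 2) * (p' * x ^ 2 + q' * x * y + r' * y ^ 2)
      = -(x ^ 2) ^ 2) : q = 0 ∧ r = 0 ∧ q' = 0 ∧ r' = 0 := by
  obtain ⟨h4, h3, h2, h1, h0⟩ := quartic_coeff_eq_zero (a := p * p' + 1) (b := p * q' + q * p')
    (c := p * r' + q * q' + r * p') (d := q * r' + r * q') (e := r * r')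
    (fun x => by linear_combination h x 1)
  have hp : p ≠ 0 := by rintro rfl; norm_num at h4
  have hp' : p' ≠ 0 := by rintro rfl; norm_num at h4
  have key : ∀ {p q r p' q' r' : ℂ}, p ≠ 0 → p' ≠ 0 → p * q' + q * p' = 0 →
      p * r' + q * q' + r * p' = 0 → q * r' + r * q' = 0 → r = 0 →
      q = 0 ∧ r = 0 ∧ q' = 0 ∧ r' = 0 := by
    rintro p q r p' q' r' hp hp' h3 h2 h1 rfl
    have hq : q = 0 := by
      by_contra hq
      have hr' : r' = 0 := by simpa [hq] using h1
      have hq' : q' = 0 := by simpa [hq, hr'] using h2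
      simp [hq', hq, hp'] at h3
    have hq' : q' = 0 := by simpa [hq, hp] using h3
    exact ⟨hq, rfl, hq', by simpa [hq, hp] using h2⟩
  rcases mul_eq_zero.mp h0 with hr | hr
  · exact key hp hp' h3 h2 h1 hr
  · obtain ⟨k1, k2, k3, k4⟩ := key (p := p') (q := q') (r := r') (p' := p) (q' := q) (r' := r) hp' hp
      (by linear_combination h3) (by linear_combination h2) (by linear_combination h1) hr
    exact ⟨k3, k4, k1, k2⟩

lemma quadratic_mul_eq_neg_sq {p q r p' q' r' : ℂ}
    (h : ∀ x y : ℂ, (p * x ^ 2 + q * x * y + r * y ^ 2) * (p' * x ^ 2 + q' * x * y + r' * y ^ 2)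
      = -(x * y) ^ 2) :
    (p = 0 ∧ r = 0 ∧ p' = 0 ∧ r' = 0) ∨ (q = 0 ∧ r = 0 ∧ p' = 0 ∧ q' = 0 ∧ p * r' = -1) ∨
      (p = 0 ∧ q = 0 ∧ q' = 0 ∧ r' = 0 ∧ r * p' = -1) := by
  obtain ⟨h4, h3, h2, h1, h0⟩ := quartic_coeff_eq_zero (a := p * p') (b := p * q' + q * p')
    (c := p * r' + q * q' + r * p' + 1) (d := q * r' + r * q') (e := r * r')
    (fun x => by linear_combination h x 1)
  by_cases hp : p = 0
  · by_cases hq : q = 0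
    · have hr : r * p' = -1 := by rw [hp, hq] at h2; linear_combination h2
      have hr0 : r ≠ 0 := by rintro rfl; norm_num at hr
      exact Or.inr (Or.inr ⟨hp, hq, by simpa [hq, hr0] using h1, by simpa [hr0] using h0, hr⟩)
    · have hp' : p' = 0 := by simpa [hp, hq] using h3
      have hq' : q' ≠ 0 := by rintro rfl; simp [hp, hp'] at h2
      rcases mul_eq_zero.mp h0 with hr | hr
      · exact Or.inl ⟨hp, hr, hp', by simpa [hr, hq] using h1⟩
      · exact Or.inl ⟨hp, by simpa [hr, hq'] using h1, hp', hr⟩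
  · have hp' : p' = 0 := by simpa [hp] using h4
    have hq' : q' = 0 := by simpa [hp, hp'] using h3
    have hr : p * r' = -1 := by rw [hp', hq'] at h2; linear_combination h2
    have hr0 : r' ≠ 0 := by rintro rfl; norm_num at hr
    exact Or.inr (Or.inl ⟨by simpa [hq', hr0] using h1, by simpa [hr0] using h0, hp', hq', hr⟩)

/-- The half sum of one pair is not a multiple of the common half difference. -/
lemma DependentQuadratics.sum_ne_smul_difference {φ : Fin 4 → ℂ → ℂ → ℂ}
    (H : DependentQuadratics φ ![1, -1, -1, 1] ![1, -1, -1, 1]) (k : ℂ) :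
    ¬ ∀ x y, φ 2 x y + φ 3 x y = k * (φ 0 x y - φ 1 x y) := by
  intro hk
  obtain ⟨h1, h2⟩ := H.eq_zero_of_two_term (i := 2) (j := 3) (p := k - 1) (q := -(k + 1))
    (by decide) fun x y => by
      have hl := H.linear x y
      simp [Fin.sum_univ_four] at hl
      linear_combination - hk x y - k * hl
  have : (2 : ℂ) = 0 := by linear_combination - h1 - h2
  norm_num at this

lemma eq_smul_of_factors {A B P R : ℂ} (hP : P = A - omega * B) (hR : R = A - omega ^ 2 * B) :
    B = (2 * omega + 1) / 3 * (P - R) := by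
  rw [hP, hR]
  linear_combination (B * (3 - 2 * omega) / 3) * omega_sq_add_omega_add_one

lemma eq_quartForm'_of_factors {A B D k μ ν x y : ℂ}
    (hμ : μ ^ 2 * (1 - omega ^ 2) = k) (hν : ν ^ 2 * (1 - omega) * k = 1) (hk : k ≠ 0)
    (hs : (Real.sqrt 3 : ℝ) * (μ * ν) = 1) (hP : A - omega * B = k * x ^ 2)
    (hR : A - omega ^ 2 * B = -y ^ 2 / k) (hD : D = x * y) :
    A + D = evalFun (quartForm' 0) (μ * x) (ν * y) ∧
    A - D = evalFun (quartForm' 1) (μ * x) (ν * y) ∧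
    B + D = evalFun (quartForm' 2) (μ * x) (ν * y) ∧
    B - D = evalFun (quartForm' 3) (μ * x) (ν * y) := by
  have hω := omega_sq_add_omega_add_one
  have hR' : A - omega ^ 2 * B = -(ν ^ 2 * (1 - omega) * y ^ 2) := by
    rw [hR, div_eq_iff hk]
    linear_combination y ^ 2 * hν
  rw [← hμ] at hP
  have hω1 : omega - 1 ≠ 0 := by
    intro h
    rw [sub_eq_zero.mp h] at hω
    norm_num at hω
  have hB : B = omega * (μ * x) ^ 2 - omega ^ 2 * (ν * y) ^ 2 := by
    have hω0 : omega ≠ 0 := fun h => by rw [h] at hω; norm_num at hω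
    apply mul_left_cancel₀ (mul_ne_zero hω0 hω1)
    linear_combination hP - hR'
      - ((μ * x) ^ 2 + (ν * y) ^ 2 * (1 - omega)) * omega_pow_three
  have hA : A = (μ * x) ^ 2 - (ν * y) ^ 2 := by
    linear_combination hP + omega * hB - (ν * y) ^ 2 * omega_pow_three
  have hD' : D = (Real.sqrt 3 : ℝ) * (μ * x) * (ν * y) := by
    rw [hD]
    linear_combination - x * y * hs
  obtain ⟨e0, e1, e2, e3⟩ := evalFun_quartForm' (μ * x) (ν * y)
  rw [e0, e1, e2, e3, hA, hB, hD']
  refine ⟨by ring, by ring, ?_, ?_⟩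
  · linear_combination (-omega * (μ * x) ^ 2
      - (Real.sqrt 3 : ℝ) * (μ * x) * (ν * y)) * omega_pow_three
  · linear_combination (-omega * (μ * x) ^ 2
      + (Real.sqrt 3 : ℝ) * (μ * x) * (ν * y)) * omega_pow_three

lemma exists_scaling {k : ℂ} (hk : k ≠ 0) : ∃ μ ν : ℂ, μ ≠ 0 ∧ ν ≠ 0 ∧
    μ ^ 2 * (1 - omega ^ 2) = k ∧ ν ^ 2 * (1 - omega) * k = 1 ∧
    (Real.sqrt 3 : ℝ) * (μ * ν) = 1 := by
  have hω := omega_sq_add_omega_add_one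
  have h3 : (1 - omega) * (1 - omega ^ 2) = 3 := by
    linear_combination (omega - 2) * hω
  have h1 : 1 - omega ^ 2 ≠ 0 := by
    intro h
    rw [h] at h3
    norm_num at h3
  have hs : ((Real.sqrt 3 : ℝ) : ℂ) ≠ 0 := by
    intro h
    have := sqrt_three_sq
    rw [h] at this
    norm_num at this
  obtain ⟨μ, hμ⟩ := IsAlgClosed.exists_pow_nat_eq (k / (1 - omega ^ 2)) (n := 2) (by norm_num)
  have hμ0 : μ ≠ 0 := by
    rintro rfl
    exact div_ne_zero hk h1 (by rw [← hμ]; norm_num)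
  rw [eq_div_iff h1] at hμ
  have hs' : ((Real.sqrt 3 : ℝ) : ℂ) * (μ * (1 / ((Real.sqrt 3 : ℝ) * μ))) = 1 := by
    field_simp
  refine ⟨μ, 1 / ((Real.sqrt 3 : ℝ) * μ), hμ0, one_div_ne_zero (mul_ne_zero hs hμ0), hμ, ?_, hs'⟩
  rw [div_pow, mul_pow, sqrt_three_sq, ← hμ, one_pow]
  field_simp
  linear_combination h3

/-- The normalised four term relation `G₀⁴ + G₃⁴ = G₁⁴ + G₂⁴`, `G₀ + G₃ = G₁ + G₂` with
`G₀ - G₁` normalised to a square has no solution. -/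
lemma DependentQuadratics.difference_ne_sq {φ : Fin 4 → ℂ → ℂ → ℂ}
    (H : DependentQuadratics φ ![1, -1, -1, 1] ![1, -1, -1, 1]) :
    ¬ ∀ x y, φ 0 x y - φ 1 x y = 2 * x ^ 2 := by
  intro hD
  choose a b c hφ using H.quad
  obtain ⟨p, hp⟩ : ∃ p : ℂ → (Fin 4 → ℂ) → ℂ,
    p = fun w a => (a 0 + a 1 - w * (a 2 + a 3)) / 2 := ⟨_, rfl⟩
  have hf : ∀ w x y, p w a * x ^ 2 + p w b * x * y + p w c * y ^ 2
      = (φ 0 x y + φ 1 x y) / 2 - w * ((φ 2 x y + φ 3 x y) / 2) := fun w x y => by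
    simp only [hp, hφ]; ring
  obtain ⟨h1, h2, h3, h4⟩ := quadratic_mul_eq_neg_fourth_power (p := p omega a) (q := p omega b)
    (r := p omega c) (p' := p (omega ^ 2) a) (q' := p (omega ^ 2) b) (r' := p (omega ^ 2) c)
    fun x y => by
      rw [hf, hf]
      have := H.norm_equation x y
      rw [hD] at this
      linear_combination this / 4 + ((φ 2 x y + φ 3 x y) ^ 2 / 4 * (omega - 1)
        - (φ 0 x y + φ 1 x y) * (φ 2 x y + φ 3 x y) / 4) * omega_sq_add_omega_add_one
  refine H.sum_ne_smul_difference ((2 * omega + 1) / 3 * (p omega a - p (omega ^ 2) a))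
    fun x y => ?_
  have := eq_smul_of_factors (hf omega x y) (hf (omega ^ 2) x y)
  rw [h1, h2, h3, h4] at this
  rw [hD]
  linear_combination 2 * this

lemma DependentQuadratics.funCousin_of_difference_eq_mul {φ : Fin 4 → ℂ → ℂ → ℂ}
    (H : DependentQuadratics φ ![1, -1, -1, 1] ![1, -1, -1, 1])
    (hD : ∀ x y, φ 0 x y - φ 1 x y = 2 * (x * y)) :
    FunCousin φ (fun j => evalFun (quartForm' ((![0, 1, 2, 3] : Fin 4 → Fin 6) j))) := by
  choose a b c hφ using H.quad
  obtain ⟨p, hp⟩ : ∃ p : ℂ → (Fin 4 → ℂ) → ℂ,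
    p = fun w a => (a 0 + a 1 - w * (a 2 + a 3)) / 2 := ⟨_, rfl⟩
  have hf : ∀ w x y, p w a * x ^ 2 + p w b * x * y + p w c * y ^ 2
      = (φ 0 x y + φ 1 x y) / 2 - w * ((φ 2 x y + φ 3 x y) / 2) := fun w x y => by
    simp only [hp, hφ]; ring
  have hD' : ∀ x y, φ 2 x y - φ 3 x y = 2 * (x * y) := fun x y => by
    have hl := H.linear x y
    simp [Fin.sum_univ_four] at hl
    linear_combination hD x y - hl
  have hφ' : ∀ x y,
      φ 0 x y = (φ 0 x y + φ 1 x y) / 2 + x * y ∧ φ 1 x y = (φ 0 x y + φ 1 x y) / 2 - x * y ∧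
      φ 2 x y = (φ 2 x y + φ 3 x y) / 2 + x * y ∧ φ 3 x y = (φ 2 x y + φ 3 x y) / 2 - x * y :=
    fun x y => ⟨by linear_combination hD x y / 2, by linear_combination -hD x y / 2,
      by linear_combination hD' x y / 2, by linear_combination -hD' x y / 2⟩
  rcases quadratic_mul_eq_neg_sq (p := p omega a) (q := p omega b)
    (r := p omega c) (p' := p (omega ^ 2) a) (q' := p (omega ^ 2) b) (r' := p (omega ^ 2) c)
    fun x y => by
      rw [hf, hf]
      have := H.norm_equation x y
      rw [hD] at this
      linear_combination this / 4 + ((φ 2 x y + φ 3 x y) ^ 2 / 4 * (omega - 1)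
        - (φ 0 x y + φ 1 x y) * (φ 2 x y + φ 3 x y) / 4) * omega_sq_add_omega_add_one
    with ⟨h1, h2, h3, h4⟩ | ⟨h1, h2, h3, h4, h5⟩ | ⟨h1, h2, h3, h4, h5⟩
  · refine (H.sum_ne_smul_difference ((2 * omega + 1) / 3 * (p omega b - p (omega ^ 2) b))
      fun x y => ?_).elim
    have := eq_smul_of_factors (hf omega x y) (hf (omega ^ 2) x y)
    rw [h1, h2, h3, h4] at this
    rw [hD]
    linear_combination 2 * this
  · have hk : p omega a ≠ 0 := by intro h; rw [h] at h5; norm_num at h5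
    obtain ⟨μ, ν, hμ0, hν0, hμ, hν, hs⟩ := exists_scaling hk
    refine ⟨μ, 0, 0, ν, 1, 1, by simp [hμ0, hν0], fun _ => one_ne_zero, fun j x y => ?_⟩
    obtain ⟨e0, e1, e2, e3⟩ := hφ' x y
    obtain ⟨g0, g1, g2, g3⟩ := eq_quartForm'_of_factors hμ hν hk hs (x := x) (y := y)
      (A := (φ 0 x y + φ 1 x y) / 2) (B := (φ 2 x y + φ 3 x y) / 2) (D := x * y)
      (by rw [← hf, h1, h2]; ring)
      (by rw [← hf, h3, h4, eq_div_iff hk]; linear_combination y ^ 2 * h5) rfl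
    fin_cases j
    · simpa [← e0] using g0
    · simpa [← e1] using g1
    · simpa [← e2] using g2
    · simpa [← e3] using g3
  · have hk : p omega c ≠ 0 := by intro h; rw [h] at h5; norm_num at h5
    obtain ⟨μ, ν, hμ0, hν0, hμ, hν, hs⟩ := exists_scaling hk
    refine ⟨0, μ, ν, 0, 1, 1, by simp [hμ0, hν0], fun _ => one_ne_zero, fun j x y => ?_⟩
    obtain ⟨e0, e1, e2, e3⟩ := hφ' x y
    obtain ⟨g0, g1, g2, g3⟩ := eq_quartForm'_of_factors hμ hν hk hs (x := y) (y := x)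
      (A := (φ 0 x y + φ 1 x y) / 2) (B := (φ 2 x y + φ 3 x y) / 2) (D := x * y)
      (by rw [← hf, h1, h2]; ring)
      (by rw [← hf, h3, h4, eq_div_iff hk]; linear_combination x ^ 2 * h5) (mul_comm _ _)
    fin_cases j
    · simpa [← e0] using g0
    · simpa [← e1] using g1
    · simpa [← e2] using g2
    · simpa [← e3] using g3

lemma DependentQuadratics.funCousin_of_signs {φ : Fin 4 → ℂ → ℂ → ℂ}
    (H : DependentQuadratics φ ![1, -1, -1, 1] ![1, -1, -1, 1]) :
    FunCousin φ (fun j => evalFun (quartForm' ((![0, 1, 2, 3] : Fin 4 → Fin 6) j))) := by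
  obtain ⟨a, b, c, d, hM, hnf⟩ : ∃ a b c d : ℂ, a * d - b * c ≠ 0 ∧
      ((∀ x y, φ 0 (a * x + b * y) (c * x + d * y) - φ 1 (a * x + b * y) (c * x + d * y)
        = 2 * (x * y)) ∨
       (∀ x y, φ 0 (a * x + b * y) (c * x + d * y) - φ 1 (a * x + b * y) (c * x + d * y)
        = 2 * x ^ 2)) := by
    obtain ⟨p, q, r, h0⟩ := H.quad 0
    obtain ⟨p', q', r', h1⟩ := H.quad 1
    have hne : ¬ ((p - p') / 2 = 0 ∧ (q - q') / 2 = 0 ∧ (r - r') / 2 = 0) := by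
      rintro ⟨e1, e2, e3⟩
      refine H.not_proportional 0 1 (by decide) 1 fun x y => ?_
      rw [h0, h1]
      linear_combination 2 * x ^ 2 * e1 + 2 * x * y * e2 + 2 * y ^ 2 * e3
    obtain ⟨a, b, c, d, hM, h | h⟩ := exists_quadratic_normal_form hne
    · exact ⟨a, b, c, d, hM, Or.inl fun x y => by
        rw [h0, h1]; linear_combination 2 * h x y⟩
    · exact ⟨a, b, c, d, hM, Or.inr fun x y => by
        rw [h0, h1]; linear_combination 2 * h x y⟩
  have H' := H.transform hM 1 (cs := 1) (fun _ => one_ne_zero)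
  have e : (fun j => (![1, -1, -1, 1] : Fin 4 → ℂ) ((1 : Equiv.Perm (Fin 4)) j) /
      (1 : Fin 4 → ℂ) j ^ 4) = ![1, -1, -1, 1] := by ext; simp
  have e' : (fun j => (![1, -1, -1, 1] : Fin 4 → ℂ) ((1 : Equiv.Perm (Fin 4)) j) /
      (1 : Fin 4 → ℂ) j) = ![1, -1, -1, 1] := by ext; simp
  rw [e, e'] at H'
  rcases hnf with hnf | hnf
  · exact (funCousin_transform φ hM 1 (cs := 1) (fun _ => one_ne_zero)).trans
      (H'.funCousin_of_difference_eq_mul (by simpa using hnf))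
  · exact (H'.difference_ne_sq (by simpa using hnf)).elim

lemma DependentQuadratics.rescale {φ : Fin 4 → ℂ → ℂ → ℂ} {l h : Fin 4 → ℂ} {t : ℂ} (ht : t ≠ 0)
    (H : DependentQuadratics φ (fun i => t * l i) (fun i => t * h i)) :
    DependentQuadratics φ l h := by
  refine ⟨H.quad, H.not_proportional, fun i => right_ne_zero_of_mul (H.coeff_ne i),
    fun x y => ?_, fun x y => ?_⟩
  · have := H.quartic x y
    simp only [mul_assoc, ← Finset.mul_sum] at this
    exact (mul_eq_zero.mp this).resolve_left ht
  · have := H.linear x y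
    simp only [mul_assoc, ← Finset.mul_sum] at this
    exact (mul_eq_zero.mp this).resolve_left ht

lemma DependentQuadratics.exists_sign_pattern {φ : Fin 4 → ℂ → ℂ → ℂ} {s : Fin 4 → ℂ}
    (H : DependentQuadratics φ s s) (hinf : φ 0 1 0 ^ 3 ≠ φ 3 1 0 ^ 3) :
    (∃ k : Fin 4 → ℂ, k ≠ 0 ∧ k 3 = 0 ∧ ∀ x y, ∑ i, k i * φ i x y = 0) ∨
    ∃ σ : Equiv.Perm (Fin 4), s (σ 1) ^ 3 = - s (σ 0) ^ 3 ∧ s (σ 2) ^ 3 = - s (σ 0) ^ 3 ∧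
      s (σ 3) ^ 3 = s (σ 0) ^ 3 := by
  choose a b c hφ using H.quad
  by_cases hdet : a 0 * (b 1 * c 2 - b 2 * c 1) - b 0 * (a 1 * c 2 - a 2 * c 1)
      + c 0 * (a 1 * b 2 - a 2 * b 1) = 0
  · left
    obtain ⟨v, hv, hv0⟩ := (Matrix.exists_mulVec_eq_zero_iff
      (M := !![a 0, a 1, a 2; b 0, b 1, b 2; c 0, c 1, c 2])).mpr (by
        rw [Matrix.det_fin_three]
        simp
        linear_combination hdet)
    refine ⟨![v 0, v 1, v 2, 0], fun h0 => hv ?_, rfl, fun x y => ?_⟩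
    · ext i
      fin_cases i
      · exact congrFun h0 0
      · exact congrFun h0 1
      · exact congrFun h0 2
    · have h0 := congrFun hv0 0
      have h1 := congrFun hv0 1
      have h2 := congrFun hv0 2
      simp [Matrix.mulVec, dotProduct, Fin.sum_univ_three] at h0 h1 h2
      simp [Fin.sum_univ_four, hφ]
      linear_combination x ^ 2 * h0 + x * y * h1 + y ^ 2 * h2
  right
  obtain ⟨ha, hb, hc⟩ := quadratic_coeff_eq (a := ∑ i, s i * a i) (b := ∑ i, s i * b i)
    (c := ∑ i, s i * c i) (a' := 0) (b' := 0) (c' := 0) fun x y => by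
      have := H.linear x y
      simp only [Fin.sum_univ_four, hφ] at this ⊢
      linear_combination this
  obtain ⟨P, hP⟩ : ∃ P : Fin 4 → ℂ → ℂ, ∀ i x, P i x = a i * x ^ 2 + b i * x + c i :=
    ⟨_, fun _ _ => rfl⟩
  obtain ⟨R, hR, hR3, hinj⟩ := Polynomial.exists_four_equal_cubes s a b c H.coeff_ne ha hb hc
    (fun x => by simpa [hφ] using H.quartic x 1) hdet ⟨0, by simpa [hφ] using hinf⟩
  simp only [← hP] at hR3 hinj
  have hne : ∀ p ∈ R, ∀ i, P i p ≠ 0 := fun p hp i h0 => by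
    have := (hR3 p hp).2 i
    rw [h0] at this
    exact (hR3 p hp).1 (by simpa using this.symm)
  have hsum : ∀ (σ : Equiv.Perm (Fin 4)) p, s (σ 0) * P (σ 0) p + s (σ 1) * P (σ 1) p
      + s (σ 2) * P (σ 2) p + s (σ 3) * P (σ 3) p = 0 := fun σ p => by
    rw [← Fin.sum_univ_four (fun i => s (σ i) * P (σ i) p),
      Equiv.sum_comp σ (fun i => s i * P i p), ← H.linear p 1]
    refine Finset.sum_congr rfl fun i _ => ?_
    rw [hP, hφ]; ring
  refine sign_pattern H.coeff_ne fun σ => ?_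
  have hcube : ∀ p ∈ R, ∀ i j, P i p ^ 3 = P j p ^ 3 := fun p hp i j =>
    ((hR3 p hp).2 i).trans ((hR3 p hp).2 j).symm
  have hcard : (Polynomial.nthRoots 3 (1 : ℂ)).toFinset.card < R.card := by
    have h1 := Multiset.toFinset_card_le (Polynomial.nthRoots 3 (1 : ℂ))
    have h2 := Polynomial.card_nthRoots 3 (1 : ℂ)
    omega
  obtain ⟨p, hp, q, hq, hpq, hr⟩ := Finset.exists_ne_map_eq_of_card_lt_of_maps_to hcard
    (f := fun p => P (σ 1) p / P (σ 0) p) (fun p hp => by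
      have := hcube p hp (σ 1) (σ 0)
      simp only [Finset.mem_coe, Multiset.mem_toFinset]
      rw [Polynomial.mem_nthRoots (by norm_num), div_pow, this,
        div_self (pow_ne_zero _ (hne p hp _))])
  have hp0 := hne p hp (σ 0)
  have hq0 := hne q hq (σ 0)
  simp only [div_eq_div_iff hp0 hq0] at hr
  refine sum_dichotomy (H.coeff_ne _) (H.coeff_ne _) hp0 hq0 (hcube p hp _ _) (hcube p hp _ _)
    (hcube p hp _ _) (hcube q hq _ _) (hcube q hq _ _) hr (hsum σ p) (hsum σ q) ?_
  rintro ⟨h2, h3⟩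
  refine hpq (hinj p hp q hq (P (σ 0) p / P (σ 0) q) fun i => ?_)
  obtain ⟨j, rfl⟩ := σ.surjective i
  rw [div_mul_eq_mul_div, eq_div_iff hq0]
  fin_cases j
  · rfl
  · change P (σ 1) p * P (σ 0) q = P (σ 0) p * P (σ 1) q
    linear_combination hr
  · change P (σ 2) p * P (σ 0) q = P (σ 0) p * P (σ 2) q
    linear_combination h2
  · change P (σ 3) p * P (σ 0) q = P (σ 0) p * P (σ 3) q
    linear_combination h3

/-- Some point of the affine line separates the cubes of two quadratics. -/
lemma DependentQuadratics.exists_cube_ne {φ : Fin 4 → ℂ → ℂ → ℂ} {l h : Fin 4 → ℂ}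
    (H : DependentQuadratics φ l h) {i j : Fin 4} (hij : i ≠ j) :
    ∃ z, φ i z 1 ^ 3 ≠ φ j z 1 ^ 3 := by
  by_contra! hc
  choose a b c hφ using H.quad
  obtain ⟨q, hq⟩ : ∃ q : Fin 4 → Polynomial ℂ, ∀ i, q i = Polynomial.C (a i) * Polynomial.X ^ 2
    + Polynomial.C (b i) * Polynomial.X + Polynomial.C (c i) := ⟨_, fun _ => rfl⟩
  have hne : ∀ w : ℂ, q i - Polynomial.C w * q j ≠ 0 := fun w h0 => by
    obtain ⟨-, -, h2, h1, h0⟩ := quartic_coeff_eq_zero (a := 0) (b := 0) (c := a i - w * a j)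
      (d := b i - w * b j) (e := c i - w * c j) fun x => by
        have := congrArg (Polynomial.eval x) h0
        simp [hq] at this
        linear_combination this
    refine H.not_proportional i j hij w fun x y => ?_
    rw [hφ, hφ]
    linear_combination x ^ 2 * h2 + x * y * h1 + y ^ 2 * h0
  refine mul_ne_zero (mul_ne_zero (hne 1) (hne omega)) (hne (omega ^ 2)) ?_
  apply Polynomial.funext
  intro x
  have := hc x
  simp only [hφ] at this
  simp only [hq, Polynomial.eval_mul, Polynomial.eval_sub, Polynomial.eval_add, Polynomial.eval_C,
    Polynomial.eval_pow, Polynomial.eval_X, Polynomial.eval_zero]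
  obtain ⟨u, hu⟩ : ∃ u, u = a i * x ^ 2 + b i * x + c i := ⟨_, rfl⟩
  obtain ⟨v, hv⟩ : ∃ v, v = a j * x ^ 2 + b j * x + c j := ⟨_, rfl⟩
  have huv : u ^ 3 = v ^ 3 := by
    rw [hu, hv]
    linear_combination this
  rw [← hu, ← hv]
  linear_combination huv + (omega * u * v ^ 2 - u ^ 2 * v) * omega_sq_add_omega_add_one
    - v ^ 3 * omega_pow_three

lemma DependentQuadratics.funCousin_of_sign_pattern {φ : Fin 4 → ℂ → ℂ → ℂ} {s : Fin 4 → ℂ}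
    (H : DependentQuadratics φ s s) {σ : Equiv.Perm (Fin 4)} (h1 : s (σ 1) ^ 3 = - s (σ 0) ^ 3)
    (h2 : s (σ 2) ^ 3 = - s (σ 0) ^ 3) (h3 : s (σ 3) ^ 3 = s (σ 0) ^ 3) :
    FunCousin φ (fun j => evalFun (quartForm' ((![0, 1, 2, 3] : Fin 4 → Fin 6) j))) := by
  have hs := H.coeff_ne
  obtain ⟨ε, hε⟩ : ∃ ε : Fin 4 → ℂ, ε = ![1, -1, -1, 1] := ⟨_, rfl⟩
  have hε2 : ∀ i, ε i * ε i = 1 := fun i => by fin_cases i <;> simp [hε]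
  have hsε : ∀ i, s (σ i) ^ 3 = ε i * s (σ 0) ^ 3 := fun i => by
    fin_cases i <;> simp [hε, h1, h2, h3]
  have hε0 : ∀ i, ε i ≠ 0 := fun i h0 => by simpa [h0] using hε2 i
  have hcs : ∀ i, ε i * s (σ i) / s (σ 0) ≠ 0 := fun i =>
    div_ne_zero (mul_ne_zero (hε0 i) (hs _)) (hs _)
  have H' := H.transform (a := 1) (b := 0) (c := 0) (d := 1) (by norm_num) σ hcs
  have e : (fun j => s (σ j) / (ε j * s (σ j) / s (σ 0)) ^ 4) = fun j => s (σ 0) * ε j := by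
    ext j
    have k1 := hε0 j
    have k2 := hs (σ j)
    have k3 := hs (σ 0)
    rw [div_eq_iff (pow_ne_zero _ (hcs j))]
    field_simp
    linear_combination (-ε j ^ 5) * hsε j + (- ε j ^ 4 * s (σ 0) ^ 3
      - ε j ^ 2 * s (σ 0) ^ 3 - s (σ 0) ^ 3) * hε2 j
  have e' : (fun j => s (σ j) / (ε j * s (σ j) / s (σ 0))) = fun j => s (σ 0) * ε j := by
    ext j
    have k1 := hε0 j
    have k2 := hs (σ j)
    have k3 := hs (σ 0)
    field_simp
    linear_combination - hε2 j
  rw [e, e'] at H'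
  have H'' := H'.rescale (hs (σ 0))
  rw [hε] at H''
  refine (funCousin_transform φ (a := 1) (b := 0) (c := 0) (d := 1) (by norm_num) σ hcs).trans ?_
  rw [hε]
  exact H''.funCousin_of_signs

theorem DependentQuadratics.classification {φ : Fin 4 → ℂ → ℂ → ℂ} {l h : Fin 4 → ℂ}
    (H : DependentQuadratics φ l h) (hh : h ≠ 0) :
    FunCousin φ (fun i => evalFun (quartForm i)) ∨
    FunCousin φ (fun j => evalFun (quartForm' ((![0, 1, 2, 3] : Fin 4 → Fin 6) j))) := by
  by_cases h0 : ∃ i, h i = 0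
  · obtain ⟨i, hi⟩ := h0
    exact Or.inl (H.funCousin_of_eq_zero hi hh)
  push Not at h0
  have hl := H.coeff_ne
  choose μ hμ using fun i => IsAlgClosed.exists_pow_nat_eq (h i / l i) (n := 3) (by norm_num)
  have hμ0 : ∀ i, μ i ≠ 0 := fun i h1 => by
    have := hμ i
    rw [h1, zero_pow (by norm_num), eq_comm] at this
    exact div_ne_zero (h0 i) (hl i) this
  have hcs : ∀ i, 1 / μ i ≠ 0 := fun i => one_div_ne_zero (hμ0 i)
  have e : (fun j => l ((1 : Equiv.Perm (Fin 4)) j) / (1 / μ j) ^ 4) = fun j => h j * μ j := by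
    ext j
    have := hμ j
    rw [eq_div_iff (hl j)] at this
    rw [Equiv.Perm.one_apply, ← this]
    field_simp
  have e' : (fun j => h ((1 : Equiv.Perm (Fin 4)) j) / (1 / μ j)) = fun j => h j * μ j := by
    ext j
    simp
  have key : ∃ z, (1 / μ 0 * φ 0 z 1) ^ 3 ≠ (1 / μ 3 * φ 3 z 1) ^ 3 := by
    have H' := H.transform (a := 1) (b := 0) (c := 0) (d := 1) (by norm_num) 1 hcs
    simpa using H'.exists_cube_ne (i := 0) (j := 3) (by decide)
  obtain ⟨z, hz⟩ := key
  have hM : z * 0 - 1 * 1 ≠ (0 : ℂ) := by norm_num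
  have H' := H.transform hM 1 hcs
  rw [e, e'] at H'
  have hc := funCousin_transform φ hM 1 hcs
  rcases H'.exists_sign_pattern (by simpa using hz) with ⟨k, hk, hk3, hk0⟩ | ⟨σ, h1, h2, h3⟩
  · have H'' : DependentQuadratics _ _ k :=
      ⟨H'.quad, H'.not_proportional, H'.coeff_ne, H'.quartic, hk0⟩
    exact Or.inl (hc.trans (H''.funCousin_of_eq_zero hk3 hk))
  · exact Or.inr (hc.trans (H'.funCousin_of_sign_pattern h1 h2 h3))

/-- Four vectors in a three-dimensional space are linearly dependent. -/
lemma exists_linear_relation (a b c : Fin 4 → ℂ) :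
    ∃ h : Fin 4 → ℂ, h ≠ 0 ∧ ∑ i, h i * a i = 0 ∧ ∑ i, h i * b i = 0 ∧ ∑ i, h i * c i = 0 := by
  obtain ⟨v, hv, hv0⟩ := (Matrix.exists_mulVec_eq_zero_iff
    (M := Matrix.of ![a, b, c, 0])).mpr (Matrix.det_eq_zero_of_row_eq_zero 3 fun _ => rfl)
  refine ⟨v, hv, ?_, ?_, ?_⟩
  · simpa [Matrix.mulVec, dotProduct, mul_comm] using congrFun hv0 0
  · simpa [Matrix.mulVec, dotProduct, mul_comm] using congrFun hv0 1
  · simpa [Matrix.mulVec, dotProduct, mul_comm] using congrFun hv0 2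

/-- Every `𝒲_2(4,4)` set is a cousin of `{A_1, A_2, A_3, A_4}` or a
cousin of a 4-element subset of `{g_1,…,g_6}` whose fourth powers are linearly
dependent over `ℂ`. -/
theorem W2_four_four_classification
    (f : Fin 4 → MvPolynomial (Fin 2) ℂ) (lam : Fin 4 → ℂ)
    (hhom : ∀ i, (f i).IsHomogeneous 2)
    (hne : ∀ i, f i ≠ 0)
    (hprop : ∀ i j, i ≠ j → ∀ c : ℂ, f i ≠ c • f j)
    (hlam : ∀ i, lam i ≠ 0)
    (hdep : ∑ i, lam i • f i ^ 4 = 0) :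
    Cousin f quartForm ∨
    ∃ s : Fin 4 → Fin 6, Function.Injective s ∧
      ¬ LinearIndependent ℂ (fun j : Fin 4 => quartForm' (s j) ^ 4) ∧
      Cousin f (fun j => quartForm' (s j)) := by
  choose a b c hf using fun i => evalFun_of_isHomogeneous (hhom i)
  obtain ⟨h, hh, ha, hb, hc⟩ := exists_linear_relation a b c
  have H : DependentQuadratics (fun i => evalFun (f i)) lam h := by
    refine ⟨fun i => ⟨a i, b i, c i, hf i⟩, fun i j hij k hk => ?_, hlam, fun x y => ?_,
      fun x y => ?_⟩
    · refine hprop i j hij k (evalFun_injective fun x y => ?_)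
      rw [hk]
      simp [evalFun]
    · have := congrArg (fun p => evalFun p x y) hdep
      simpa [evalFun, map_sum, smul_eval] using this
    · simp only [Fin.sum_univ_four, hf] at ha hb hc ⊢
      linear_combination x ^ 2 * ha + x * y * hb + y ^ 2 * hc
  rcases H.classification hh with h1 | h1
  · exact Or.inl h1.cousin
  · exact Or.inr ⟨![0, 1, 2, 3], by decide, quartForm'_fourth_powers_dependent, h1.cousin⟩
end

section
/- Let s ≥ 1 and ζ_{2s+2} = e^{2πi/(2s+2)}. Then in ℂ[x,y]: (1/(s+1)) · Σ_{j=0}^{s} (ζ_{2s+2}^{−j} x + ζ_{2s+2}^{j} y)^{2s} = C(2s, s) · x^s y^s, where C(2s,s) is the central binomial coefficient. -/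
open MvPolynomial Finset

/-- For a primitive `(2s+2)`-nd root of unity `ζ`, the powers of `ζ ^ (2s - 2m)` sum to zero
over `j = 0, …, s`, unless `m = s`. -/
theorem IsPrimitiveRoot.sum_inv_pow_mul_pow {K : Type*} [Field K] {ζ : K} {s : ℕ}
    (hζ : IsPrimitiveRoot ζ (2 * s + 2)) {m : ℕ} (hm : m ≤ 2 * s) :
    ∑ j ∈ Finset.range (s + 1), (ζ⁻¹ ^ j) ^ m * (ζ ^ j) ^ (2 * s - m) =
      if m = s then (s + 1 : K) else 0 := by
  have h0 : ζ ≠ 0 := hζ.ne_zero (by omega)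
  have hq : ∀ j : ℕ, (ζ⁻¹ ^ j) ^ m * (ζ ^ j) ^ (2 * s - m) =
      (ζ ^ (2 * s - 2 * m : ℤ)) ^ j := by
    intro j
    have hexp : (2 * s - 2 * m : ℤ) * j = -(j * m : ℕ) + (j * (2 * s - m) : ℕ) := by
      push_cast [Nat.cast_sub hm]
      ring
    rw [← zpow_natCast (ζ ^ (2 * s - 2 * m : ℤ)), ← zpow_mul, hexp, zpow_add₀ h0, zpow_neg,
      zpow_natCast, zpow_natCast, ← pow_mul, ← pow_mul, inv_pow]
  simp_rw [hq]
  split_ifs with h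
  · simp [h]
  · have hne : ζ ^ (2 * s - 2 * m : ℤ) ≠ 1 := by
      rw [Ne, hζ.zpow_eq_one_iff_dvd]
      intro hdvd
      have := Int.eq_zero_of_abs_lt_dvd hdvd (by rw [abs_lt]; constructor <;> push_cast <;> omega)
      omega
    have hone : (ζ ^ (2 * s - 2 * m : ℤ)) ^ (s + 1) = 1 := by
      rw [← zpow_natCast, ← zpow_mul, hζ.zpow_eq_one_iff_dvd]
      exact ⟨s - m, by push_cast; ring⟩
    rw [geom_sum_eq hne, hone, sub_self, zero_div]

/-- With `ζ = ζ_{2s+2} = e^{2πi/(2s+2)}`, in `ℂ[x,y]`: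
`(1/(s+1)) Σ_{j=0}^{s} (ζ^{−j} x + ζ^{j} y)^{2s} = C(2s,s) x^s y^s`. -/
theorem central_monomial_identity (s : ℕ) (hs : 1 ≤ s) :
    C ((1 : ℂ) / (s + 1)) *
      ∑ j ∈ Finset.range (s + 1),
        (C ((Complex.exp (2 * (Real.pi : ℂ) * Complex.I / ((2 * s + 2 : ℕ) : ℂ)))⁻¹ ^ j) * Px +
         C ((Complex.exp (2 * (Real.pi : ℂ) * Complex.I / ((2 * s + 2 : ℕ) : ℂ))) ^ j) * Py) ^ (2 * s)
    = C (((2 * s).choose s : ℂ)) * Px ^ s * Py ^ s := by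
  have hζ := Complex.isPrimitiveRoot_exp (2 * s + 2) (by omega)
  set ζ := Complex.exp (2 * (Real.pi : ℂ) * Complex.I / ((2 * s + 2 : ℕ) : ℂ))
  have hs1 : (s + 1 : ℂ) ≠ 0 := by exact_mod_cast s.succ_ne_zero
  have hterm : ∀ m ∈ Finset.range (2 * s + 1),
      ∑ j ∈ Finset.range (s + 1), (C (ζ⁻¹ ^ j) * Px) ^ m * (C (ζ ^ j) * Py) ^ (2 * s - m) *
          ((2 * s).choose m : MvPolynomial (Fin 2) ℂ) =
        C (if m = s then (s + 1 : ℂ) else 0) *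
          (Px ^ m * Py ^ (2 * s - m) * ((2 * s).choose m : MvPolynomial (Fin 2) ℂ)) := by
    intro m hm
    rw [← hζ.sum_inv_pow_mul_pow (Finset.mem_range_succ_iff.mp hm), map_sum, Finset.sum_mul]
    refine Finset.sum_congr rfl fun j _ => ?_
    simp only [map_mul, map_pow]
    ring
  simp_rw [add_pow]
  rw [Finset.sum_comm, Finset.sum_congr rfl hterm, Finset.sum_eq_single_of_mem s
    (Finset.mem_range.mpr (by omega)) fun m _ hm => by simp [hm], if_pos rfl, ← mul_assoc,
    ← C_mul, one_div_mul_cancel hs1, C_1, one_mul, map_natCast,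
    show 2 * s - s = s by omega]
  ring
end

section
/- Let d ≥ 3 and let f_1, f_2, f_3, f_4 be nonzero pairwise non-proportional binary quadratic forms over ℂ with f_1^d + f_2^d = f_3^d + f_4^d. Then f_1 and f_2 are relatively prime, and f_3 and f_4 are relatively prime. Moreover, if f_1 and f_2 are both even (of the form α x² + β y²), then f_3 and f_4 are not both even. -/
open MvPolynomial Finset

/-- A binary quadratic form is *even* if it has the shape `α x² + β y²`. -/
def IsEvenQuadratic (g : MvPolynomial (Fin 2) ℂ) : Prop :=
  ∃ α β : ℂ, g = C α * Px ^ 2 + C β * Py ^ 2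

/-- The linear form `a x + b y`. -/
noncomputable def linearForm (a b : ℂ) : MvPolynomial (Fin 2) ℂ := C a * X 0 + C b * X 1

lemma linearForm_zero : linearForm 0 0 = 0 := by simp [linearForm]

lemma smul_linearForm (k a b : ℂ) : k • linearForm a b = linearForm (k * a) (k * b) := by
  simp only [linearForm, smul_eq_C_mul, C_mul]; ring

lemma isHomogeneous_linearForm (a b : ℂ) : (linearForm a b).IsHomogeneous 1 :=
  (((isHomogeneous_C _ a).mul (isHomogeneous_X ℂ 0)).add
    ((isHomogeneous_C _ b).mul (isHomogeneous_X ℂ 1)))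

lemma prime_linearForm {a b : ℂ} (h : linearForm a b ≠ 0) : Prime (linearForm a b) := by
  refine Irreducible.prime (irreducible_of_totalDegree_eq_one
    ((isHomogeneous_linearForm a b).totalDegree h) fun r hr => ?_)
  rw [isUnit_iff_ne_zero]
  rintro rfl
  exact h (MvPolynomial.ext _ _ fun m => by simpa using hr m)

lemma det_ne_zero_of_not_proportional {a b c e : ℂ}
    (h₁ : ∀ k : ℂ, linearForm a b ≠ k • linearForm c e)
    (h₂ : ∀ k : ℂ, linearForm c e ≠ k • linearForm a b) : a * e - c * b ≠ 0 := by
  intro h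
  by_cases hc : c = 0
  · by_cases he : e = 0
    · subst hc he
      exact h₂ 0 (by simp [linearForm_zero])
    · apply h₁ (b / e)
      rw [smul_linearForm]
      congr 1 <;> field_simp
      linear_combination h
  · apply h₁ (a / c)
    rw [smul_linearForm]
    congr 1 <;> field_simp
    linear_combination -h

lemma exists_coeff_of_isHomogeneous_two {f : MvPolynomial (Fin 2) ℂ} (hf : f.IsHomogeneous 2) :
    ∃ α β γ : ℂ, f = C α * X 0 ^ 2 + C β * (X 0 * X 1) + C γ * X 1 ^ 2 := by
  classical
  refine ⟨f.coeff (Finsupp.single 0 2), f.coeff (Finsupp.single 0 1 + Finsupp.single 1 1),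
    f.coeff (Finsupp.single 1 2), ?_⟩
  have hm : (X 0 * X 1 : MvPolynomial (Fin 2) ℂ) =
      monomial (Finsupp.single 0 1 + Finsupp.single 1 1) 1 := by
    simp [X, monomial_mul]
  ext m
  rw [hm, X_pow_eq_monomial, X_pow_eq_monomial]
  simp only [coeff_add, coeff_C_mul, coeff_monomial, Finsupp.ext_iff, Fin.forall_fin_two,
    Finsupp.add_apply, Finsupp.single_apply]
  by_cases h : m.degree = 2
  · have h' : m 0 + m 1 = 2 := by
      simpa [Finsupp.degree_eq_sum] using h
    have hm' : m = Finsupp.single 0 (m 0) + Finsupp.single 1 (m 1) := by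
      ext i; fin_cases i <;> simp
    obtain h0 | h0 | h0 : m 0 = 0 ∨ m 0 = 1 ∨ m 0 = 2 := by omega
    · have h1 : m 1 = 2 := by omega
      rw [h0, h1] at hm'
      simp [hm']
    · have h1 : m 1 = 1 := by omega
      rw [h0, h1] at hm'
      simp [hm']
    · have h1 : m 1 = 0 := by omega
      rw [h0, h1] at hm'
      simp [hm']
  · rw [hf.coeff_eq_zero h]
    have h' : m 0 + m 1 ≠ 2 := by
      simpa [Finsupp.degree_eq_sum] using h
    rw [if_neg (by simp; omega), if_neg (by simp; omega), if_neg (by simp; omega)]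
    simp

lemma exists_eq_linearForm_mul {f : MvPolynomial (Fin 2) ℂ} (hf : f.IsHomogeneous 2) :
    ∃ a b c e : ℂ, f = linearForm a b * linearForm c e := by
  obtain ⟨α, β, γ, rfl⟩ := exists_coeff_of_isHomogeneous_two hf
  by_cases hα : α = 0
  · refine ⟨0, 1, β, γ, ?_⟩
    simp only [hα, linearForm, C_0, C_1]
    ring
  · obtain ⟨s, hs⟩ := IsAlgClosed.exists_pow_nat_eq (β ^ 2 - 4 * α * γ) (n := 2) (by norm_num)
    refine ⟨α, (β + s) / 2, 1, (β - s) / (2 * α), ?_⟩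
    have h1 : α * ((β - s) / (2 * α)) + (β + s) / 2 = β := by field_simp; ring
    have h2 : (β + s) / 2 * ((β - s) / (2 * α)) = γ := by
      field_simp
      linear_combination -hs
    have h1' := congrArg (C (σ := Fin 2)) h1
    have h2' := congrArg (C (σ := Fin 2)) h2
    simp only [C_add, C_mul] at h1' h2'
    simp only [linearForm, C_1]
    linear_combination -(X 0 * X 1) * h1' - X 1 ^ 2 * h2'

lemma exists_smul_of_linearForm_dvd {a b c e : ℂ} (h : linearForm a b ∣ linearForm c e) :
    ∃ k : ℂ, linearForm c e = k • linearForm a b := by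
  obtain ⟨q, hq⟩ := h
  by_cases h0 : linearForm c e = 0
  · exact ⟨0, by simp [h0]⟩
  have hl : linearForm a b ≠ 0 := by rintro h; simp [h] at hq; exact h0 hq
  have hq0 : q ≠ 0 := by rintro rfl; simp at hq; exact h0 hq
  have := congrArg totalDegree hq
  rw [totalDegree_mul_of_isDomain hl hq0, (isHomogeneous_linearForm a b).totalDegree hl,
    (isHomogeneous_linearForm c e).totalDegree h0] at this
  have hk := totalDegree_eq_zero_iff_eq_C.1 (show q.totalDegree = 0 by omega)
  exact ⟨q.coeff 0, by rw [smul_eq_C_mul, mul_comm, ← hk, hq]⟩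

lemma exists_cofactor_of_linearForm_dvd {a b : ℂ} (hl : linearForm a b ≠ 0)
    {f : MvPolynomial (Fin 2) ℂ} (hf : f.IsHomogeneous 2) (h : linearForm a b ∣ f) :
    ∃ c e : ℂ, f = linearForm a b * linearForm c e := by
  obtain ⟨p, q, r, s, rfl⟩ := exists_eq_linearForm_mul hf
  rcases (prime_linearForm hl).dvd_or_dvd h with h | h
  · obtain ⟨k, hk⟩ := exists_smul_of_linearForm_dvd h
    exact ⟨k * r, k * s, by rw [hk, ← smul_linearForm, smul_mul_assoc, mul_smul_comm]⟩
  · obtain ⟨k, hk⟩ := exists_smul_of_linearForm_dvd h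
    exact ⟨k * p, k * q, by
      rw [hk, ← smul_linearForm, mul_comm, smul_mul_assoc, mul_smul_comm]⟩

lemma coeff_C_mul_X_add_C_pow (a b : ℂ) (d k : ℕ) :
    ((Polynomial.C b * Polynomial.X + Polynomial.C a) ^ d).coeff k =
      a ^ (d - k) * b ^ k * d.choose k := by
  have : (Polynomial.C b * Polynomial.X + Polynomial.C a) ^ d =
      ((Polynomial.X + Polynomial.C a) ^ d).comp (Polynomial.C b * Polynomial.X) := by simp
  rw [this, Polynomial.comp_C_mul_X_coeff, Polynomial.coeff_X_add_C_pow]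
  ring

/-- Four pairwise non-proportional linear forms have no relation `ℓ₀ ^ d + ℓ₁ ^ d = ℓ₂ ^ d + ℓ₃ ^ d`
with `d ≥ 3`. -/
lemma linearForm_pow_add_pow_ne {d : ℕ} (hd : 3 ≤ d) (a b : Fin 4 → ℂ)
    (hprop : ∀ i j, i ≠ j → ∀ k : ℂ, linearForm (a i) (b i) ≠ k • linearForm (a j) (b j)) :
    linearForm (a 0) (b 0) ^ d + linearForm (a 1) (b 1) ^ d ≠
      linearForm (a 2) (b 2) ^ d + linearForm (a 3) (b 3) ^ d := by
  intro heq
  have hdet (j : Fin 4) (hj : 0 ≠ j) : a 0 * b j - a j * b 0 ≠ 0 :=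
    det_ne_zero_of_not_proportional (hprop 0 j hj) (hprop j 0 hj.symm)
  have hcoeff (k l : ℕ) (hkl : l + k = d) :
      a 0 ^ l * b 0 ^ k + a 1 ^ l * b 1 ^ k = a 2 ^ l * b 2 ^ k + a 3 ^ l * b 3 ^ k := by
    have hl : d - k = l := by omega
    have h := congrArg (fun p => (aeval ![(1 : Polynomial ℂ), Polynomial.X] p).coeff k) heq
    have hL (i : Fin 4) : aeval ![(1 : Polynomial ℂ), Polynomial.X] (linearForm (a i) (b i)) =
        Polynomial.C (b i) * Polynomial.X + Polynomial.C (a i) := by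
      simp [linearForm, add_comm]
    simp only [map_add, map_pow, hL, Polynomial.coeff_add, coeff_C_mul_X_add_C_pow, hl] at h
    have hc : (d.choose k : ℂ) ≠ 0 := by
      exact_mod_cast (Nat.choose_pos (by omega)).ne'
    apply mul_right_cancel₀ hc
    linear_combination h
  obtain ⟨n, rfl⟩ := Nat.exists_eq_add_of_le hd
  have hP : (a 0 * b 1 - a 1 * b 0) * (a 0 * b 2 - a 2 * b 0) * (a 0 * b 3 - a 3 * b 0) ≠ 0 :=
    mul_ne_zero (mul_ne_zero (hdet 1 (by decide)) (hdet 2 (by decide))) (hdet 3 (by decide))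
  have ha : a 0 ^ n = 0 := by
    refine (mul_eq_zero.1 ?_).resolve_left hP
    linear_combination (b 1 * b 2 * b 3) * hcoeff 0 (n + 3) (by omega)
      - (a 1 * b 2 * b 3 + b 1 * a 2 * b 3 + b 1 * b 2 * a 3) * hcoeff 1 (n + 2) (by omega)
      + (a 1 * a 2 * b 3 + a 1 * b 2 * a 3 + b 1 * a 2 * a 3) * hcoeff 2 (n + 1) (by omega)
      - (a 1 * a 2 * a 3) * hcoeff 3 n (by omega)
  have hb : b 0 ^ n = 0 := by
    refine (mul_eq_zero.1 ?_).resolve_left hP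
    linear_combination (b 1 * b 2 * b 3) * hcoeff n 3 (by omega)
      - (a 1 * b 2 * b 3 + b 1 * a 2 * b 3 + b 1 * b 2 * a 3) * hcoeff (n + 1) 2 (by omega)
      + (a 1 * a 2 * b 3 + a 1 * b 2 * a 3 + b 1 * a 2 * a 3) * hcoeff (n + 2) 1 (by omega)
      - (a 1 * a 2 * a 3) * hcoeff (n + 3) 0 (by omega)
  apply hdet 1 (by decide)
  rw [eq_zero_of_pow_eq_zero ha, eq_zero_of_pow_eq_zero hb]
  simp

/-- If the `d`-th power of a prime `p` divides `f ^ d + g ^ d`, then `p` divides both `f` and `g`,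
or `p ^ d` divides a linear combination `f - k g`. -/
lemma dvd_or_pow_dvd_sub_smul {p f g : MvPolynomial (Fin 2) ℂ} (hp : Prime p) {d : ℕ} (hd : 0 < d)
    (h : p ^ d ∣ f ^ d + g ^ d) : (p ∣ f ∧ p ∣ g) ∨ ∃ k : ℂ, p ^ d ∣ f - k • g := by
  classical
  obtain ⟨c, hc⟩ := IsAlgClosed.exists_pow_nat_eq (-1 : ℂ) hd
  have hζ := (Complex.isPrimitiveRoot_exp d hd.ne').map_of_injective
    (C_injective (Fin 2) ℂ)
  have hsum : f ^ d + g ^ d = f ^ d - (C c * g) ^ d := by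
    rw [mul_pow, ← C_pow, hc]; simp
  rw [hsum, hζ.pow_sub_pow_eq_prod_sub_mul _ _ hd] at h
  obtain ⟨ζ, hζmem, hζdvd⟩ := (hp.dvd_finsetProd_iff _).1 ((dvd_pow_self p hd.ne').trans h)
  have hC : ∀ η ∈ Polynomial.nthRootsFinset d (1 : MvPolynomial (Fin 2) ℂ),
      ∃ z : ℂ, η = C z := by
    intro η hη
    have : NeZero d := ⟨hd.ne'⟩
    obtain ⟨i, -, hi⟩ := hζ.eq_pow_of_pow_eq_one
      ((Polynomial.mem_nthRootsFinset hd _).1 hη)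
    exact ⟨_, by rw [← hi, ← C_pow]⟩
  by_cases hother : p ∣ ∏ η ∈ (Polynomial.nthRootsFinset d 1).erase ζ, (f - η * (C c * g))
  · left
    obtain ⟨η, hη, hηdvd⟩ := (hp.dvd_finsetProd_iff _).1 hother
    obtain ⟨hne, hηmem⟩ := Finset.mem_erase.1 hη
    obtain ⟨z, rfl⟩ := hC ζ hζmem
    obtain ⟨w, rfl⟩ := hC η hηmem
    have hu : IsUnit (C ((w - z) * c) : MvPolynomial (Fin 2) ℂ) := by
      apply IsUnit.map
      rw [isUnit_iff_ne_zero]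
      refine mul_ne_zero (sub_ne_zero.2 fun h => hne (by rw [h])) ?_
      rintro rfl
      simp [hd.ne'] at hc
    have hg : p ∣ g := by
      rw [← hu.dvd_mul_left]
      convert dvd_sub hζdvd hηdvd using 1
      simp only [C_mul, C_sub]; ring
    refine ⟨?_, hg⟩
    have := dvd_add hζdvd ((hg.mul_left (C c)).mul_left (C z))
    rwa [sub_add_cancel] at this
  · right
    rw [← Finset.mul_prod_erase _ _ hζmem] at h
    obtain ⟨z, rfl⟩ := hC ζ hζmem
    refine ⟨z * c, ?_⟩
    have := hp.pow_dvd_of_dvd_mul_right d hother h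
    rwa [← mul_assoc, ← C_mul, ← smul_eq_C_mul] at this

lemma exists_linearForm_dvd_of_not_isRelPrime {f g : MvPolynomial (Fin 2) ℂ}
    (hf : f.IsHomogeneous 2) (hf0 : f ≠ 0)
    (h : ¬ IsRelPrime f g) :
    ∃ a b : ℂ, linearForm a b ≠ 0 ∧ linearForm a b ∣ f ∧ linearForm a b ∣ g := by
  simp only [IsRelPrime, not_forall] at h
  obtain ⟨q, hqf, hqg, hq⟩ := h
  have hq0 : q ≠ 0 := ne_zero_of_dvd_ne_zero hf0 hqf
  obtain ⟨p, hp, hpq⟩ := WfDvdMonoid.exists_irreducible_factor hq hq0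
  have key {a b : ℂ} (hl : linearForm a b ≠ 0) (h : p ∣ linearForm a b) : linearForm a b ∣ p :=
    hp.dvd_symm (prime_linearForm hl).irreducible h
  obtain ⟨a, b, c, e, rfl⟩ := exists_eq_linearForm_mul hf
  rcases hp.prime.dvd_or_dvd (hpq.trans hqf) with h | h
  · have hl := left_ne_zero_of_mul hf0
    exact ⟨a, b, hl, dvd_mul_right _ _, (key hl h).trans (hpq.trans hqg)⟩
  · have hl := right_ne_zero_of_mul hf0
    exact ⟨c, e, hl, dvd_mul_left _ _, (key hl h).trans (hpq.trans hqg)⟩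

lemma isRelPrime_of_pow_add_pow_eq {d : ℕ} (hd : 3 ≤ d) (f : Fin 4 → MvPolynomial (Fin 2) ℂ)
    (hhom : ∀ i, (f i).IsHomogeneous 2) (hprop : ∀ i j, i ≠ j → ∀ c : ℂ, f i ≠ c • f j)
    (heq : f 0 ^ d + f 1 ^ d = f 2 ^ d + f 3 ^ d) : IsRelPrime (f 0) (f 1) := by
  by_contra hrel
  have hf0 : f 0 ≠ 0 := fun h => hprop 0 1 (by decide) 0 (by simp [h])
  obtain ⟨p, q, hl, h0, h1⟩ :=
    exists_linearForm_dvd_of_not_isRelPrime (hhom 0) hf0 hrel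
  have hdvd : linearForm p q ^ d ∣ f 2 ^ d + f 3 ^ d :=
    heq ▸ dvd_add (pow_dvd_pow_of_dvd h0 d) (pow_dvd_pow_of_dvd h1 d)
  rcases dvd_or_pow_dvd_sub_smul (prime_linearForm hl) (by omega) hdvd with ⟨h2, h3⟩ | ⟨k, hk⟩
  · have hall (i : Fin 4) : ∃ c e : ℂ, f i = linearForm p q * linearForm c e := by
      apply exists_cofactor_of_linearForm_dvd hl (hhom i)
      fin_cases i <;> assumption
    choose a b hab using hall
    refine linearForm_pow_add_pow_ne hd a b (fun i j hij k hk => hprop i j hij k ?_) ?_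
    · rw [hab i, hab j, hk, mul_smul_comm]
    · simp only [hab, mul_pow, ← mul_add] at heq
      exact mul_left_cancel₀ (pow_ne_zero d hl) heq
  · have hne : f 2 - k • f 3 ≠ 0 := sub_ne_zero.2 (hprop 2 3 (by decide) k)
    have hdeg : (f 2 - k • f 3).totalDegree ≤ 2 := by
      refine IsHomogeneous.totalDegree_le ((hhom 2).sub ?_)
      rw [smul_eq_C_mul]
      exact (hhom 3).C_mul k
    have hle := totalDegree_le_of_dvd_of_isDomain hk hne
    rw [((isHomogeneous_linearForm p q).pow d).totalDegree (pow_ne_zero d hl)] at hle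
    omega

/-- If `d ≥ 3` and `f_1, f_2, f_3, f_4` are nonzero, pairwise
non-proportional binary quadratic forms over `ℂ` with `f_1^d + f_2^d = f_3^d + f_4^d`,
then `f_1, f_2` are relatively prime and `f_3, f_4` are relatively prime;
moreover, if `f_1` and `f_2` are both even, then `f_3, f_4` are not both even. -/
theorem coprimality_and_not_both_even (d : ℕ) (hd : 3 ≤ d)
    (f : Fin 4 → MvPolynomial (Fin 2) ℂ)
    (hhom : ∀ i, (f i).IsHomogeneous 2)
    (hne : ∀ i, f i ≠ 0)
    (hprop : ∀ i j, i ≠ j → ∀ c : ℂ, f i ≠ c • f j)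
    (heq : f 0 ^ d + f 1 ^ d = f 2 ^ d + f 3 ^ d) :
    IsRelPrime (f 0) (f 1) ∧ IsRelPrime (f 2) (f 3) ∧
      (IsEvenQuadratic (f 0) ∧ IsEvenQuadratic (f 1) →
        ¬ (IsEvenQuadratic (f 2) ∧ IsEvenQuadratic (f 3))) := by
  refine ⟨isRelPrime_of_pow_add_pow_eq hd f hhom hprop heq, ?_, ?_⟩
  · have hinj : Function.Injective ![(2 : Fin 4), 3, 0, 1] := by decide
    exact isRelPrime_of_pow_add_pow_eq hd (f ∘ ![2, 3, 0, 1]) (fun i => hhom _)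
      (fun i j hij => hprop _ _ (hinj.ne hij)) heq.symm
  · rintro ⟨h0, h1⟩ ⟨h2, h3⟩
    have hall (i : Fin 4) : ∃ a b : ℂ, f i = expand 2 (linearForm a b) := by
      have : IsEvenQuadratic (f i) := by fin_cases i <;> assumption
      obtain ⟨a, b, h⟩ := this
      exact ⟨a, b, by simp [h, linearForm, Px, Py]⟩
    choose a b hab using hall
    refine linearForm_pow_add_pow_ne hd a b (fun i j hij k hk => hprop i j hij k ?_) ?_
    · rw [hab i, hab j, hk, map_smul]
    · simp only [hab, ← map_pow, ← map_add] at heq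
      exact expand_injective (by norm_num) heq
end

section
/- Let S ∈ ℂ[t_1, …, t_6] be a symmetric homogeneous polynomial of degree 7 (invariant under all permutations of the variables t_1,…,t_6). Then S lies in the ideal of ℂ[t_1,…,t_6] generated by the power sums p_1 = t_1+⋯+t_6, p_2 = t_1²+⋯+t_6², and p_4 = t_1⁴+⋯+t_6⁴. -/
open MvPolynomial Finset

/-- The `k`-th elementary symmetric polynomial is homogeneous of degree `k`. -/
lemma MvPolynomial.isHomogeneous_esymm_of_fintype (σ R : Type*) [Fintype σ] [CommSemiring R]
    (k : ℕ) : (esymm σ R k).IsHomogeneous k := by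
  refine IsHomogeneous.sum _ _ _ fun s hs => ?_
  have h := IsHomogeneous.prod s (fun i => (X i : MvPolynomial σ R)) (fun _ => 1)
    fun i _ => isHomogeneous_X R i
  rwa [sum_const, smul_eq_mul, mul_one, (mem_powersetCard.mp hs).2] at h

/-- An ideal containing the power sums `p_1`, `p_2`, `p_4` contains `e_1`, `e_2`, `e_4`. -/
lemma esymm_one_two_four_mem_of_psum_mem {σ : Type*} [Fintype σ]
    {I : Ideal (MvPolynomial σ ℂ)}
    (h1 : psum σ ℂ 1 ∈ I) (h2 : psum σ ℂ 2 ∈ I) (h4 : psum σ ℂ 4 ∈ I) :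
    esymm σ ℂ 1 ∈ I ∧ esymm σ ℂ 2 ∈ I ∧ esymm σ ℂ 4 ∈ I := by
  have cancel : ∀ (c : ℂ) (f : MvPolynomial σ ℂ), c ≠ 0 → C c * f ∈ I → f ∈ I := by
    intro c f hc hf
    simpa [← mul_assoc, ← C_mul, hc] using I.mul_mem_left (C c⁻¹) hf
  have e1 : esymm σ ℂ 1 ∈ I := by rwa [esymm_one, ← psum_one]
  refine ⟨e1, cancel 2 _ two_ne_zero ?_, cancel 4 _ (by norm_num) ?_⟩
  · have h := mul_esymm_eq_sum σ ℂ 2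
    rw [Nat.cast_ofNat] at h
    rw [map_ofNat, h]
    refine I.mul_mem_left _ (I.sum_mem fun a ha => I.mul_mem_left _ ?_)
    have key : ∀ a ∈ antidiagonal 2, a.1 < 2 → a.2 = 1 ∨ a.2 = 2 := by decide
    obtain ⟨ha, hlt⟩ := mem_filter.mp ha
    rcases key a ha hlt with h | h <;> rw [h]
    · exact h1
    · exact h2
  · have h := mul_esymm_eq_sum σ ℂ 4
    rw [Nat.cast_ofNat] at h
    rw [map_ofNat, h]
    refine I.mul_mem_left _ (I.sum_mem fun a ha => ?_)
    have key : ∀ a ∈ antidiagonal 4, a.1 < 4 → a.1 = 1 ∨ a.2 = 1 ∨ a.2 = 2 ∨ a.2 = 4 := by decide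
    obtain ⟨ha, hlt⟩ := mem_filter.mp ha
    rcases key a ha hlt with h | h | h | h <;> rw [h]
    · exact I.mul_mem_right _ (I.mul_mem_left _ e1)
    · exact I.mul_mem_left _ h1
    · exact I.mul_mem_left _ h2
    · exact I.mul_mem_left _ h4

/-- Every symmetric homogeneous polynomial `S ∈ ℂ[t_1,…,t_6]` of
degree 7 lies in the ideal generated by the power sums
`p_1 = Σ t_j`, `p_2 = Σ t_j²`, `p_4 = Σ t_j⁴`. -/
theorem symmetric_degree_seven_in_power_sum_ideal
    (S : MvPolynomial (Fin 6) ℂ)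
    (hhom : S.IsHomogeneous 7) (hsym : S.IsSymmetric) :
    S ∈ Ideal.span
      ({∑ j : Fin 6, X j, ∑ j : Fin 6, X j ^ 2, ∑ j : Fin 6, X j ^ 4} :
        Set (MvPolynomial (Fin 6) ℂ)) := by
  set I := Ideal.span
      ({∑ j : Fin 6, X j, ∑ j : Fin 6, X j ^ 2, ∑ j : Fin 6, X j ^ 4} :
        Set (MvPolynomial (Fin 6) ℂ))
  obtain ⟨e1, e2, e4⟩ := esymm_one_two_four_mem_of_psum_mem (I := I)
    (by rw [psum_one]; exact Ideal.subset_span (by simp))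
    (Ideal.subset_span (by simp [psum])) (Ideal.subset_span (by simp [psum]))
  obtain ⟨q, hq⟩ := esymmAlgHom_fin_surjective ℂ (le_refl 6) ⟨S, hsym⟩
  have hS : S = ∑ t ∈ q.support, C (q.coeff t) * ∏ i : Fin 6, esymm (Fin 6) ℂ (i + 1) ^ t i := by
    have h := congrArg Subtype.val hq
    rw [esymmAlgHom_apply, aeval_def, eval₂_eq'] at h
    exact h.symm
  have hterm : ∀ t : Fin 6 →₀ ℕ, (C (q.coeff t) *
      ∏ i : Fin 6, esymm (Fin 6) ℂ (i + 1) ^ t i).IsHomogeneous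
        (∑ i : Fin 6, ((i : ℕ) + 1) * t i) := fun t =>
    (IsHomogeneous.prod _ _ _ fun i _ =>
      (isHomogeneous_esymm_of_fintype _ _ _).pow (t i)).C_mul _
  rw [← homogeneousComponent_eq_self hhom, hS, map_sum]
  refine I.sum_mem fun t _ => ?_
  rw [homogeneousComponent_of_mem (hterm t)]
  split_ifs with hw
  swap
  · exact I.zero_mem
  have mem_of : ∀ i : Fin 6, t i ≠ 0 → esymm (Fin 6) ℂ (i + 1) ∈ I →
      C (q.coeff t) * ∏ i : Fin 6, esymm (Fin 6) ℂ (i + 1) ^ t i ∈ I := fun i hi hmem =>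
    I.mul_mem_left _ <| I.mem_of_dvd
      (dvd_prod_of_mem (fun i : Fin 6 => esymm (Fin 6) ℂ (i + 1) ^ t i) (mem_univ i))
      (I.pow_mem_of_mem hmem _ (Nat.pos_of_ne_zero hi))
  by_cases h0 : t 0 = 0
  · by_cases h1 : t 1 = 0
    · refine mem_of 3 (fun h3 => ?_) e4
      simp [Fin.sum_univ_six, h0, h1, h3] at hw
      omega
    · exact mem_of 1 h1 e2
  · exact mem_of 0 h0 e1
end
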